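/- Let n≥1 and let τ lie in the upper half-plane with p=e^{iπτ}. Then, as z₁,…,z_{2n} tend to 0 through pairwise distinct values, lim P_n^{(1)}(z₁,…,z_{2n};τ) / ∏_{1≤i<j≤2n}(z_i−z_j) = ((2iC₁)ⁿ · D₁^{n(2n−1)} / ∏_{j=1}^{2n}(j−1)!) · det_{1≤i,j≤n}(L_{i+j−2}^{(1)}), where C₁=(p;p)_∞/((p²;p²)_∞²(p³;p³)_∞), D₁=2π(−p⁶;p⁶)_∞², and for j≥0, L_j^{(1)} = (−1)^{j+1}T_j + Σ_{k=1}^∞ ((k+1)/3)·(−1)^k·(p^{2k−1}/(1−p^{2k−1}))·(2k−1)^{2j+1}, with T_j the Glaisher T-numbers. -/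

import Mathlib

open Complex BigOperators Finset

noncomputable section

def qpoch (a p : ℂ) : ℂ := ∏' j : ℕ, (1 - a * p ^ j)

def theta (x p : ℂ) : ℂ := qpoch x p * qpoch (p / x) p

def pf {m : ℕ} (A : Matrix (Fin (2 * m)) (Fin (2 * m)) ℂ) : ℂ :=
  (1 / (2 ^ m * (Nat.factorial m) : ℂ)) *
    ∑ σ : Equiv.Perm (Fin (2 * m)), ((Equiv.Perm.sign σ : ℤ) : ℂ) *
      ∏ j : Fin m, A (σ ⟨2 * (j : ℕ), by have := j.isLt; omega⟩)
        (σ ⟨2 * (j : ℕ) + 1, by have := j.isLt; omega⟩)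

def pPow (τ lam : ℂ) : ℂ := Complex.exp (Real.pi * Complex.I * τ * lam)

def xOf (z : ℂ) : ℂ := Complex.exp (Real.pi * Complex.I * z)

def leg (k : ℤ) : ℤ := if k % 3 = 0 then 0 else if k % 3 = 1 then 1 else -1

def P1 (n : ℕ) (τ : ℂ) (z : Fin (2 * n) → ℂ) : ℂ :=
  let p : ℂ → ℂ := fun lam => pPow τ lam
  let x : Fin (2 * n) → ℂ := fun j => xOf (z j)
  (∏ i, ∏ j, if i < j then
      (x j) ^ 3 / (x i) ^ 3 * theta (-((x i) ^ 6 / (x j) ^ 6)) (p 6) else 1) *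
  pf (fun i j => x i / x j *
      theta ((x i) ^ 2 / (x j) ^ 2) (p 2) * theta (-((x i) ^ 2 / (x j) ^ 2)) (p 2) *
      theta (p 1 * ((x i) ^ 2 / (x j) ^ 2)) (p 2) /
      theta (-((x i) ^ 6 / (x j) ^ 6)) (p 6))

def C1 (p : ℂ) : ℂ := qpoch p p / (qpoch (p ^ 2) (p ^ 2) ^ 2 * qpoch (p ^ 3) (p ^ 3))

def D1 (p : ℂ) : ℂ := 2 * Real.pi * qpoch (-p ^ 6) (p ^ 6) ^ 2

/-- Glaisher's T-numbers, defined by `sin(2z)/(2cos(3z)) = Σ T_n z^{2n+1}/(2n+1)!`. -/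
def glaisherT (j : ℕ) : ℂ :=
  iteratedDeriv (2 * j + 1) (fun z : ℂ => Complex.sin (2 * z) / (2 * Complex.cos (3 * z))) 0

/-- The Lambert-type series `L_j^{(1)}`. -/
def L1 (p : ℂ) (j : ℕ) : ℂ :=
  (-1) ^ (j + 1) * glaisherT j +
    ∑' k : ℕ, (leg ((k : ℤ) + 2) : ℂ) * (-1) ^ (k + 1) *
      (p ^ (2 * k + 1) / (1 - p ^ (2 * k + 1))) * (2 * (k : ℂ) + 1) ^ (2 * j + 1)

section QPochhammer

variable {p : ℂ}

theorem multipliable_one_sub_mul_pow (hp : ‖p‖ < 1) (a : ℂ) :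
    Multipliable fun j : ℕ => 1 - a * p ^ j := by
  simp only [sub_eq_add_neg]
  apply multipliable_one_add_of_summable
  simp only [norm_neg, norm_mul, norm_pow]
  exact (summable_geometric_of_lt_one (norm_nonneg _) hp).mul_left _

theorem qpoch_eq_mul (hp : ‖p‖ < 1) (a : ℂ) : qpoch a p = (1 - a) * qpoch (a * p) p := by
  unfold qpoch
  have h := multipliable_one_sub_mul_pow hp (a * p)
  rw [tprod_eq_zero_mul']
  · simp [pow_succ', mul_assoc]
  · simpa [pow_succ', mul_assoc] using h

theorem qpoch_ne_zero (hp : ‖p‖ < 1) {a : ℂ} (ha : ∀ j : ℕ, a * p ^ j ≠ 1) : qpoch a p ≠ 0 := by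
  unfold qpoch
  simp only [sub_eq_add_neg]
  apply tprod_one_add_ne_zero_of_summable
  · intro j h
    exact ha j (by linear_combination -h)
  · simp only [norm_neg, norm_mul, norm_pow]
    exact (summable_geometric_of_lt_one (norm_nonneg _) hp).mul_left _

theorem qpoch_ne_zero_of_norm_lt_one (hp : ‖p‖ < 1) {a : ℂ} (ha : ‖a‖ < 1) : qpoch a p ≠ 0 := by
  refine qpoch_ne_zero hp fun j h => ?_
  have h1 : ‖a * p ^ j‖ < 1 := by
    rw [norm_mul, norm_pow]
    exact mul_lt_one_of_nonneg_of_lt_one_left (norm_nonneg _) ha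
      (pow_le_one₀ (norm_nonneg _) hp.le)
  simp [h] at h1

theorem differentiable_qpoch (hp : ‖p‖ < 1) : Differentiable ℂ fun a => qpoch a p := by
  intro a
  have hu : Summable fun j : ℕ => (‖a‖ + 1) * ‖p‖ ^ j :=
    (summable_geometric_of_lt_one (norm_nonneg _) hp).mul_left _
  have hd : DifferentiableOn ℂ (fun a => ∏' j : ℕ, (1 + -(a * p ^ j)))
      (Metric.ball 0 (‖a‖ + 1)) := by
    have h := hu.hasProdLocallyUniformlyOn_nat_one_add (f := fun (j : ℕ) (a : ℂ) => -(a * p ^ j))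
      (K := Metric.ball 0 (‖a‖ + 1)) Metric.isOpen_ball
      (.of_forall fun n x hx => by
        rw [norm_neg, norm_mul, norm_pow]
        have : ‖x‖ < ‖a‖ + 1 := by simpa using hx
        gcongr) fun n => by fun_prop
    refine TendstoLocallyUniformlyOn.differentiableOn h (.of_forall fun s => ?_)
      Metric.isOpen_ball
    exact DifferentiableOn.fun_finsetProd fun j _ => by fun_prop
  have := hd.differentiableAt (Metric.isOpen_ball.mem_nhds (x := a) (by simp))
  simpa only [qpoch, sub_eq_add_neg] using this

theorem norm_pow_lt_one (hp : ‖p‖ < 1) {k : ℕ} (hk : k ≠ 0) : ‖p ^ k‖ < 1 := by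
  rw [norm_pow]
  exact pow_lt_one₀ (norm_nonneg _) hp hk

theorem qpoch_mul_qpoch_neg (hp : ‖p‖ < 1) (a : ℂ) :
    qpoch a p * qpoch (-a) p = qpoch (a ^ 2) (p ^ 2) := by
  unfold qpoch
  rw [← (multipliable_one_sub_mul_pow hp a).tprod_mul (multipliable_one_sub_mul_pow hp (-a))]
  refine tprod_congr fun j => ?_
  ring

theorem qpoch_mul_qpoch_mul_qpoch (hp : ‖p‖ < 1) {ω : ℂ} (hω : ω ^ 2 + ω + 1 = 0) (a : ℂ) :
    qpoch a p * qpoch (ω * a) p * qpoch (ω ^ 2 * a) p = qpoch (a ^ 3) (p ^ 3) := by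
  unfold qpoch
  rw [← (multipliable_one_sub_mul_pow hp a).tprod_mul (multipliable_one_sub_mul_pow hp (ω * a)),
    ← ((multipliable_one_sub_mul_pow hp a).mul (multipliable_one_sub_mul_pow hp (ω * a))).tprod_mul
      (multipliable_one_sub_mul_pow hp (ω ^ 2 * a))]
  refine tprod_congr fun j => ?_
  generalize hx : a * p ^ j = x
  have h1 : ω * a * p ^ j = ω * x := by rw [← hx]; ring
  have h2 : ω ^ 2 * a * p ^ j = ω ^ 2 * x := by rw [← hx]; ring
  have h3 : a ^ 3 * (p ^ 3) ^ j = x ^ 3 := by rw [← hx]; ring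
  rw [h1, h2, h3]
  linear_combination (-x + ω * x ^ 2 - (ω - 1) * x ^ 3) * hω

theorem qpoch_sq_base (hp : ‖p‖ < 1) (a : ℂ) :
    qpoch a (p ^ 2) * qpoch (a * p) (p ^ 2) = qpoch a p := by
  have hp2 := norm_pow_lt_one hp two_ne_zero
  have h1 := multipliable_one_sub_mul_pow hp2 a
  have h2 := multipliable_one_sub_mul_pow hp2 (a * p)
  unfold qpoch
  have e1 : ∀ j : ℕ, 1 - a * (p ^ 2) ^ j = 1 - a * p ^ (2 * j) := fun j => by rw [pow_mul]
  have e2 : ∀ j : ℕ, 1 - a * p * (p ^ 2) ^ j = 1 - a * p ^ (2 * j + 1) := fun j => by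
    ring
  simp only [e1, e2] at h1 h2 ⊢
  exact tprod_even_mul_odd (f := fun j => 1 - a * p ^ j) h1 h2

theorem qpoch_neg_odd_mul_neg_even (hp : ‖p‖ < 1) :
    qpoch p p * (qpoch (-p) (p ^ 2) * qpoch (-p ^ 2) (p ^ 2)) = qpoch (p ^ 2) (p ^ 2) := by
  have h := qpoch_sq_base hp (-p)
  rw [show -p * p = -p ^ 2 by ring] at h
  rw [h, qpoch_mul_qpoch_neg hp]

end QPochhammer

section Theta

variable {p : ℂ}

theorem theta_base_mul (hp : ‖p‖ < 1) {x : ℂ} (hx : x ≠ 0) (hp0 : p ≠ 0) :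
    theta (p * x) p = -(theta x p) / x := by
  unfold theta
  rw [qpoch_eq_mul hp x, show p / (p * x) = 1 / x by field_simp, qpoch_eq_mul hp (1 / x),
    show 1 / x * p = p / x by ring, mul_comm x p]
  field_simp
  ring

theorem theta_one_div (hp : ‖p‖ < 1) {x : ℂ} (hx : x ≠ 0) :
    theta (1 / x) p = -(theta x p) / x := by
  unfold theta
  rw [qpoch_eq_mul hp x, show p / (1 / x) = x * p by field_simp, qpoch_eq_mul hp (1 / x),
    show 1 / x * p = p / x by ring]
  field_simp
  ring

theorem theta_base_div (x : ℂ) (hp0 : p ≠ 0) : theta (p / x) p = theta x p := by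
  unfold theta
  rw [div_div_cancel₀ hp0, mul_comm]

theorem theta_eq_mul (hp : ‖p‖ < 1) (x : ℂ) :
    theta x p = (1 - x) * (qpoch (x * p) p * qpoch (p / x) p) := by
  rw [theta, qpoch_eq_mul hp x, mul_assoc]

theorem differentiableAt_theta (hp : ‖p‖ < 1) {x : ℂ} (hx : x ≠ 0) :
    DifferentiableAt ℂ (fun x => theta x p) x := by
  unfold theta
  have h := differentiable_qpoch hp
  exact (h x).mul ((h (p / x)).comp x (f := fun x => p / x) (by fun_prop (disch := assumption)))

end Theta

section ThetaQuotient

/-- Numerator of the theta quotient: `y θ(y², -y², p y²; p²)`. -/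
def thetaNum (p y : ℂ) : ℂ :=
  y * theta (y ^ 2) (p ^ 2) * theta (-y ^ 2) (p ^ 2) * theta (p * y ^ 2) (p ^ 2)

/-- Denominator of the theta quotient. -/
def thetaDen (p y : ℂ) : ℂ := theta (-y ^ 6) (p ^ 6)

/-- `thetaDen` with the factor `1 + y ^ 6` removed. -/
def thetaDenReg (p y : ℂ) : ℂ := qpoch (-y ^ 6 * p ^ 6) (p ^ 6) * qpoch (p ^ 6 / -y ^ 6) (p ^ 6)

/-- The character modulo twelve in the Lambert series, indexed by the odd number `2 k + 1`. -/
def lamChar (k : ℕ) : ℂ := (leg ((k : ℤ) + 2) : ℂ) * (-1) ^ (k + 1)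

/-- Coefficients of the Lambert series. -/
def lamCoeff (p : ℂ) (k : ℕ) : ℂ := lamChar k * (p ^ (2 * k + 1) / (1 - p ^ (2 * k + 1)))

/-- The Lambert series as a function of `y`. -/
def lamSeries (p y : ℂ) : ℂ := ∑' k : ℕ, lamCoeff p k * (y ^ (2 * k + 1) - (y⁻¹) ^ (2 * k + 1))

/-- The regularized product of the denominator and the Lambert expansion. -/
def lamNum (p y : ℂ) : ℂ :=
  thetaDenReg p y * (y * (1 - y ^ 4)) + thetaDen p y * lamSeries p y

variable {p : ℂ}

theorem thetaDen_eq (hp : ‖p‖ < 1) (y : ℂ) : thetaDen p y = (1 + y ^ 6) * thetaDenReg p y := by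
  rw [thetaDen, theta_eq_mul (norm_pow_lt_one hp (by norm_num)), thetaDenReg]
  ring

theorem norm_lamChar_le (k : ℕ) : ‖lamChar k‖ ≤ 1 := by
  unfold lamChar leg
  split_ifs <;> simp

theorem norm_lamCoeff_le (hp : ‖p‖ < 1) (k : ℕ) :
    ‖lamCoeff p k‖ ≤ (1 - ‖p‖)⁻¹ * ‖p‖ ^ (2 * k + 1) := by
  have h1 : 1 - ‖p‖ ≤ ‖1 - p ^ (2 * k + 1)‖ := by
    have h2 := norm_sub_norm_le 1 (p ^ (2 * k + 1))
    have h3 : ‖p ^ (2 * k + 1)‖ ≤ ‖p‖ := by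
      rw [norm_pow]
      exact pow_le_of_le_one (norm_nonneg _) hp.le (by omega)
    simp only [norm_one] at h2
    linarith
  have h0 : 0 < 1 - ‖p‖ := by linarith
  rw [lamCoeff, norm_mul, norm_div, norm_pow]
  calc ‖lamChar k‖ * (‖p‖ ^ (2 * k + 1) / ‖1 - p ^ (2 * k + 1)‖)
      ≤ 1 * (‖p‖ ^ (2 * k + 1) / (1 - ‖p‖)) := by
        gcongr
        exact norm_lamChar_le k
    _ = _ := by rw [one_mul, div_eq_inv_mul]

theorem summable_pow_odd {t : ℝ} (h0 : 0 ≤ t) (h1 : t < 1) :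
    Summable fun k : ℕ => t ^ (2 * k + 1) := by
  have := (summable_geometric_of_lt_one (sq_nonneg t) (by nlinarith : t ^ 2 < 1)).mul_left t
  refine this.congr fun k => ?_
  ring

theorem summable_lamChar_mul {y : ℂ} (h : ‖y‖ < 1) :
    Summable fun k : ℕ => lamChar k * y ^ (2 * k + 1) := by
  refine (summable_pow_odd (norm_nonneg y) h).of_norm_bounded fun k => ?_
  rw [norm_mul, norm_pow]
  exact mul_le_of_le_one_left (by positivity) (norm_lamChar_le k)

theorem summable_lamCoeff_mul (hp : ‖p‖ < 1) {y : ℂ} (h : ‖p‖ * ‖y‖ < 1) :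
    Summable fun k : ℕ => lamCoeff p k * y ^ (2 * k + 1) := by
  refine ((summable_pow_odd (by positivity) h).mul_left (1 - ‖p‖)⁻¹).of_norm_bounded fun k => ?_
  rw [norm_mul, norm_pow, mul_pow, ← mul_assoc]
  gcongr
  exact norm_lamCoeff_le hp k

theorem tsum_lamChar_mul {y : ℂ} (h : ‖y‖ < 1) :
    (1 + y ^ 6) * ∑' k : ℕ, lamChar k * y ^ (2 * k + 1) = y * (1 - y ^ 4) := by
  have hs := summable_lamChar_mul h
  have hrec : ∀ k : ℕ, lamChar (k + 3) = -lamChar k := by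
    intro k
    unfold lamChar
    have : leg (((k + 3 : ℕ) : ℤ) + 2) = leg ((k : ℤ) + 2) := by
      unfold leg
      have : (((k + 3 : ℕ) : ℤ) + 2) % 3 = ((k : ℤ) + 2) % 3 := by push_cast; omega
      rw [this]
    rw [this]; ring
  have h0 := hs.sum_add_tsum_nat_add 3
  have h1 : ∑' k : ℕ, lamChar (k + 3) * y ^ (2 * (k + 3) + 1) =
      -(y ^ 6) * ∑' k : ℕ, lamChar k * y ^ (2 * k + 1) := by
    rw [← tsum_mul_left]
    refine tsum_congr fun k => ?_
    rw [hrec]; ring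
  rw [h1] at h0
  have h2 : ∑ i ∈ range 3, lamChar i * y ^ (2 * i + 1) = y - y ^ 5 := by
    simp [Finset.sum_range_succ, lamChar, leg]
    ring
  rw [h2] at h0
  linear_combination -h0

theorem thetaNum_neg (y : ℂ) : thetaNum p (-y) = -thetaNum p y := by
  simp [thetaNum]

theorem thetaNum_inv (hp : ‖p‖ < 1) (hp0 : p ≠ 0) {y : ℂ} (hy : y ≠ 0) :
    thetaNum p y⁻¹ = -thetaNum p y / y ^ 6 := by
  have hp2 := norm_pow_lt_one hp two_ne_zero
  have h1 := theta_one_div hp2 (pow_ne_zero 2 hy)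
  have h2 := theta_one_div hp2 (neg_ne_zero.mpr (pow_ne_zero 2 hy))
  have h3 := theta_base_div (p := p ^ 2) (p * y ^ 2) (pow_ne_zero 2 hp0)
  unfold thetaNum
  rw [show (y⁻¹) ^ 2 = 1 / y ^ 2 by simp, h1, show -(1 / y ^ 2) = 1 / -y ^ 2 by rw [div_neg], h2,
    show p * (1 / y ^ 2) = p ^ 2 / (p * y ^ 2) by field_simp, h3]
  field_simp

theorem thetaNum_mul (hp : ‖p‖ < 1) (hp0 : p ≠ 0) {y : ℂ} (hy : y ≠ 0) :
    thetaNum p (p * y) = thetaNum p y / y ^ 6 := by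
  have hp2 := norm_pow_lt_one hp two_ne_zero
  have hb := pow_ne_zero 2 hp0
  have h1 := theta_base_mul hp2 (pow_ne_zero 2 hy) hb
  have h2 := theta_base_mul hp2 (neg_ne_zero.mpr (pow_ne_zero 2 hy)) hb
  have h3 := theta_base_mul hp2 (mul_ne_zero hp0 (pow_ne_zero 2 hy)) hb
  unfold thetaNum
  rw [mul_pow, h1, show -(p ^ 2 * y ^ 2) = p ^ 2 * -y ^ 2 by ring, h2,
    show p * (p ^ 2 * y ^ 2) = p ^ 2 * (p * y ^ 2) by ring, h3]
  field_simp

theorem thetaDen_inv (hp : ‖p‖ < 1) {y : ℂ} (hy : y ≠ 0) :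
    thetaDen p y⁻¹ = thetaDen p y / y ^ 6 := by
  have h2 := theta_one_div (norm_pow_lt_one hp (by norm_num : 6 ≠ 0))
    (neg_ne_zero.mpr (pow_ne_zero 6 hy))
  unfold thetaDen
  rw [show -(y⁻¹) ^ 6 = 1 / -y ^ 6 by rw [inv_pow, one_div, inv_neg], h2, neg_div_neg_eq]

theorem thetaDen_mul (hp : ‖p‖ < 1) (hp0 : p ≠ 0) {y : ℂ} (hy : y ≠ 0) :
    thetaDen p (p * y) = thetaDen p y / y ^ 6 := by
  have h2 := theta_base_mul (norm_pow_lt_one hp (by norm_num : 6 ≠ 0))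
    (neg_ne_zero.mpr (pow_ne_zero 6 hy)) (pow_ne_zero 6 hp0)
  unfold thetaDen
  rw [show -(p * y) ^ 6 = p ^ 6 * -y ^ 6 by ring, h2, neg_div_neg_eq]

theorem thetaDenReg_inv {y : ℂ} : thetaDenReg p y⁻¹ = thetaDenReg p y := by
  unfold thetaDenReg
  rw [mul_comm]
  congr 2
  · rw [inv_pow, ← inv_neg, div_inv_eq_mul, mul_comm]
  · rw [inv_pow, ← inv_neg, mul_comm, div_eq_mul_inv]

theorem lamSeries_inv (y : ℂ) : lamSeries p y⁻¹ = -lamSeries p y := by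
  unfold lamSeries
  rw [← tsum_neg]
  refine tsum_congr fun k => ?_
  rw [inv_inv]; ring

theorem lamSeries_neg (y : ℂ) : lamSeries p (-y) = -lamSeries p y := by
  unfold lamSeries
  rw [← tsum_neg]
  refine tsum_congr fun k => ?_
  rw [inv_neg, (odd_two_mul_add_one k).neg_pow, (odd_two_mul_add_one k).neg_pow]; ring

theorem lamNum_neg (y : ℂ) : lamNum p (-y) = -lamNum p y := by
  have e4 : (-y) ^ 4 = y ^ 4 := by ring
  have e6 : (-y) ^ 6 = y ^ 6 := by ring
  simp only [lamNum, lamSeries_neg, thetaDenReg, thetaDen, e4, e6]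
  ring

theorem lamNum_inv (hp : ‖p‖ < 1) {y : ℂ} (hy : y ≠ 0) :
    lamNum p y⁻¹ = -lamNum p y / y ^ 6 := by
  simp only [lamNum, lamSeries_inv, thetaDenReg_inv, thetaDen_inv hp hy]
  field_simp
  ring

theorem lamNum_mul (hp : ‖p‖ < 1) (hp0 : p ≠ 0) {y : ℂ} (h1 : 1 < ‖y‖) (h2 : ‖p‖ * ‖y‖ < 1) :
    lamNum p (p * y) = lamNum p y / y ^ 6 := by
  have hy : y ≠ 0 := by rintro rfl; simp at h1; linarith
  have hpn : 0 < ‖p‖ := norm_pos_iff.mpr hp0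
  have hinv : ‖y⁻¹‖ < 1 := by rw [norm_inv]; exact inv_lt_one_of_one_lt₀ h1
  have hpy : ‖p * y‖ < 1 := by rwa [norm_mul]
  have hpyi : ‖p‖ * ‖(p * y)⁻¹‖ < 1 := by
    rw [norm_inv, norm_mul, mul_inv, ← mul_assoc, mul_inv_cancel₀ hpn.ne', one_mul, ← norm_inv]
    exact hinv
  have hc1 := tsum_lamChar_mul hinv
  have hc2 := tsum_lamChar_mul hpy
  have hreg : ∀ z : ℂ, thetaDenReg p z * (1 + z ^ 6) = thetaDen p z := fun z => by
    rw [thetaDen_eq hp, mul_comm]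
  have key : (∑' k : ℕ, lamChar k * (p * y) ^ (2 * k + 1)) + lamSeries p (p * y) =
      -(∑' k : ℕ, lamChar k * (y⁻¹) ^ (2 * k + 1)) + lamSeries p y := by
    unfold lamSeries
    have s1 := summable_lamChar_mul hpy
    have s2 := summable_lamChar_mul hinv
    have s3 := summable_lamCoeff_mul hp (y := p * y)
      (by nlinarith [norm_nonneg (p * y)])
    have s4 := summable_lamCoeff_mul hp hpyi
    have s5 := summable_lamCoeff_mul hp h2
    have s6 := summable_lamCoeff_mul hp (y := y⁻¹) (by nlinarith [norm_nonneg y⁻¹])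
    have s34 : Summable fun k : ℕ =>
        lamCoeff p k * ((p * y) ^ (2 * k + 1) - ((p * y)⁻¹) ^ (2 * k + 1)) := by
      simpa only [mul_sub] using s3.sub s4
    have s56 : Summable fun k : ℕ =>
        lamCoeff p k * (y ^ (2 * k + 1) - (y⁻¹) ^ (2 * k + 1)) := by
      simpa only [mul_sub] using s5.sub s6
    rw [← s1.tsum_add s34, ← tsum_neg, ← s2.neg.tsum_add s56]
    refine tsum_congr fun k => ?_
    unfold lamCoeff
    have hk : 1 - p ^ (2 * k + 1) ≠ 0 := by
      intro h
      have := norm_pow_lt_one hp (by omega : 2 * k + 1 ≠ 0)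
      rw [← sub_eq_zero.mp h] at this
      simp at this
    rw [mul_inv, mul_pow, mul_pow, inv_pow, inv_pow]
    have hyk : y ^ (2 * k + 1) ≠ 0 := pow_ne_zero _ hy
    have hpk : p ^ (2 * k + 1) ≠ 0 := pow_ne_zero _ hp0
    generalize y ^ (2 * k + 1) = Y at *
    generalize p ^ (2 * k + 1) = P at *
    field_simp
    ring
  have hL : lamNum p (p * y) = thetaDen p (p * y) *
      ((∑' k : ℕ, lamChar k * (p * y) ^ (2 * k + 1)) + lamSeries p (p * y)) := by
    rw [lamNum, ← hc2, ← hreg]; ring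
  have hR : lamNum p y = thetaDen p y *
      (-(∑' k : ℕ, lamChar k * (y⁻¹) ^ (2 * k + 1)) + lamSeries p y) := by
    have : y * (1 - y ^ 4) = -(y ^ 6 * (y⁻¹ * (1 - y⁻¹ ^ 4))) := by
      field_simp; ring
    rw [lamNum, this, ← hc1, ← hreg]
    field_simp
    ring
  rw [hL, hR, key, thetaDen_mul hp hp0 hy]
  ring

theorem differentiableAt_thetaNum (hp : ‖p‖ < 1) (hp0 : p ≠ 0) {y : ℂ} (hy : y ≠ 0) :
    DifferentiableAt ℂ (thetaNum p) y := by
  have hp2 := norm_pow_lt_one hp two_ne_zero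
  have h1 := (differentiableAt_theta hp2 (pow_ne_zero 2 hy)).comp y
    (f := fun y => y ^ 2) (by fun_prop)
  have h2 := (differentiableAt_theta hp2 (neg_ne_zero.mpr (pow_ne_zero 2 hy))).comp y
    (f := fun y => -y ^ 2) (by fun_prop)
  have h3 := (differentiableAt_theta hp2 (mul_ne_zero hp0 (pow_ne_zero 2 hy))).comp y
    (f := fun y => p * y ^ 2) (by fun_prop)
  exact ((differentiableAt_id.mul h1).mul h2).mul h3

theorem differentiableAt_thetaDen (hp : ‖p‖ < 1) {y : ℂ} (hy : y ≠ 0) :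
    DifferentiableAt ℂ (thetaDen p) y :=
  (differentiableAt_theta (norm_pow_lt_one hp (by norm_num : 6 ≠ 0))
    (neg_ne_zero.mpr (pow_ne_zero 6 hy))).comp y (f := fun y => -y ^ 6) (by fun_prop)

theorem differentiableAt_thetaDenReg (hp : ‖p‖ < 1) {y : ℂ} (hy : y ≠ 0) :
    DifferentiableAt ℂ (thetaDenReg p) y := by
  have h := differentiable_qpoch (norm_pow_lt_one hp (by norm_num : 6 ≠ 0))
  have hy6 := neg_ne_zero.mpr (pow_ne_zero 6 hy)
  exact ((h _).comp y (f := fun y => -y ^ 6 * p ^ 6) (by fun_prop)).mul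
    ((h _).comp y (f := fun y => p ^ 6 / -y ^ 6) (by fun_prop (disch := assumption)))

theorem differentiableAt_lamSeries (hp : ‖p‖ < 1) {y : ℂ} (h1 : ‖p‖ < ‖y‖) (h2 : ‖p‖ * ‖y‖ < 1) :
    DifferentiableAt ℂ (lamSeries p) y := by
  have hpn := norm_nonneg p
  have hy : 0 < ‖y‖ := hpn.trans_lt h1
  obtain ⟨a, ha1, ha2⟩ := exists_between h1
  have ha0 : 0 < a := hpn.trans_lt ha1
  obtain ⟨b, hb1, hb2⟩ : ∃ b, ‖y‖ < b ∧ ‖p‖ * b < 1 := by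
    have hc : Filter.Tendsto (fun b : ℝ => ‖p‖ * b) (nhdsWithin ‖y‖ (Set.Ioi ‖y‖))
        (nhds (‖p‖ * ‖y‖)) :=
      Filter.Tendsto.mono_left (Continuous.tendsto (by fun_prop) _) nhdsWithin_le_nhds
    obtain ⟨b, hb⟩ := ((hc.eventually_lt_const h2).and self_mem_nhdsWithin).exists
    exact ⟨b, hb.2, hb.1⟩
  have hb0 : 0 < b := hy.trans hb1
  have hopen : IsOpen {z : ℂ | a < ‖z‖ ∧ ‖z‖ < b} :=
    (isOpen_lt continuous_const continuous_norm).inter (isOpen_lt continuous_norm continuous_const)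
  have hmem : {z : ℂ | a < ‖z‖ ∧ ‖z‖ < b} ∈ nhds y := hopen.mem_nhds ⟨ha2, hb1⟩
  have hpa : ‖p‖ * a⁻¹ < 1 := by rw [← div_eq_mul_inv, div_lt_one ha0]; exact ha1
  refine (differentiableOn_tsum_of_summable_norm
    (u := fun k => (1 - ‖p‖)⁻¹ * (‖p‖ * b) ^ (2 * k + 1) + (1 - ‖p‖)⁻¹ * (‖p‖ * a⁻¹) ^ (2 * k + 1))
    (((summable_pow_odd (by positivity) hb2).mul_left _).add
      ((summable_pow_odd (by positivity) hpa).mul_left _))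
    (fun k => ?_) hopen (fun k z hz => ?_)).differentiableAt hmem
  · intro z hz
    have hz0 : z ≠ 0 := norm_pos_iff.mp (ha0.trans hz.1)
    exact DifferentiableAt.differentiableWithinAt (by fun_prop (disch := assumption))
  · have hc := norm_lamCoeff_le hp k
    have hz0 : 0 < ‖z‖ := ha0.trans hz.1
    have h0 : 0 < 1 - ‖p‖ := by linarith
    calc _ ≤ ‖lamCoeff p k‖ * (‖z‖ ^ (2 * k + 1) + (‖z‖⁻¹) ^ (2 * k + 1)) := by
          rw [norm_mul]
          gcongr
          refine (norm_sub_le _ _).trans ?_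
          simp
      _ ≤ ((1 - ‖p‖)⁻¹ * ‖p‖ ^ (2 * k + 1)) * (b ^ (2 * k + 1) + (a⁻¹) ^ (2 * k + 1)) := by
          gcongr
          · exact hz.2.le
          · exact hz.1.le
      _ = _ := by rw [mul_pow, mul_pow]; ring

theorem differentiableAt_lamNum (hp : ‖p‖ < 1) {y : ℂ} (h1 : ‖p‖ < ‖y‖) (h2 : ‖p‖ * ‖y‖ < 1) :
    DifferentiableAt ℂ (lamNum p) y := by
  have hy : y ≠ 0 := norm_pos_iff.mp ((norm_nonneg p).trans_lt h1)
  exact ((differentiableAt_thetaDenReg hp hy).mul (by fun_prop)).add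
    ((differentiableAt_thetaDen hp hy).mul (differentiableAt_lamSeries hp h1 h2))

end ThetaQuotient

section LaurentUniqueness

/-- The `n`-th Laurent coefficient (up to normalization) of `g` over the circle of radius `R`. -/
def laurentInt (g : ℂ → ℂ) (n : ℤ) (R : ℝ) : ℂ :=
  ∫ θ in (0 : ℝ)..2 * Real.pi, g (circleMap 0 R θ) * circleMap 0 R θ ^ (-n)

theorem integral_mul_circleMap (F : ℂ → ℂ) (u : ℂ) (R : ℝ) :
    ∫ θ in (0 : ℝ)..2 * Real.pi, F (u * circleMap 0 R θ) =
      ∫ θ in (0 : ℝ)..2 * Real.pi, F (circleMap 0 (‖u‖ * R) θ) := by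
  have h1 : ∀ θ : ℝ, u * circleMap 0 R θ = circleMap 0 (‖u‖ * R) (θ + arg u) := by
    intro θ
    simp only [circleMap_zero]
    conv_lhs => rw [← norm_mul_exp_arg_mul_I u]
    push_cast
    rw [add_mul, exp_add]
    ring
  simp only [h1]
  rw [intervalIntegral.integral_comp_add_right (fun θ => F (circleMap 0 (‖u‖ * R) θ))]
  have hper : Function.Periodic (fun θ => F (circleMap 0 (‖u‖ * R) θ)) (2 * Real.pi) :=
    fun θ => by simp only [periodic_circleMap 0 (‖u‖ * R) θ]
  have := hper.intervalIntegral_add_eq (0 + arg u) 0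
  rw [zero_add (2 * Real.pi)] at this
  rw [← this]
  congr 1
  ring

theorem integral_inv_circleMap_one (F : ℂ → ℂ) :
    ∫ θ in (0 : ℝ)..2 * Real.pi, F (circleMap 0 1 θ)⁻¹ =
      ∫ θ in (0 : ℝ)..2 * Real.pi, F (circleMap 0 1 θ) := by
  have h1 : ∀ θ : ℝ, (circleMap 0 1 θ)⁻¹ = circleMap 0 1 (-θ) := by
    intro θ
    simp [circleMap_zero, ← exp_neg]
  simp only [h1]
  rw [intervalIntegral.integral_comp_neg (fun θ => F (circleMap 0 1 θ))]
  have hper : Function.Periodic (fun θ => F (circleMap 0 1 θ)) (2 * Real.pi) :=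
    fun θ => by simp only [periodic_circleMap 0 1 θ]
  have := hper.intervalIntegral_add_eq (-(2 * Real.pi)) 0
  simpa using this

/-- Odd functions, holomorphic on an annulus, with the transformation rules of the denominator
`θ(-y⁶; p⁶)` under `y ↦ p y` and, up to sign, under `y ↦ y⁻¹`. -/
structure ThetaLike (p : ℂ) (g : ℂ → ℂ) : Prop where
  differentiableAt : ∀ y : ℂ, ‖p‖ < ‖y‖ → ‖p‖ * ‖y‖ < 1 → DifferentiableAt ℂ g y
  neg : ∀ y : ℂ, g (-y) = -g y
  inv : ∀ y : ℂ, y ≠ 0 → g y⁻¹ = -g y / y ^ 6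
  mul : ∀ y : ℂ, 1 < ‖y‖ → ‖p‖ * ‖y‖ < 1 → g (p * y) = g y / y ^ 6

variable {p : ℂ} {g : ℂ → ℂ}

theorem ThetaLike.linearCombination {h : ℂ → ℂ} (hg : ThetaLike p g) (hh : ThetaLike p h)
    (a b : ℂ) : ThetaLike p fun y => a * g y - b * h y where
  differentiableAt y h1 h2 :=
    ((hg.differentiableAt y h1 h2).const_mul a).sub ((hh.differentiableAt y h1 h2).const_mul b)
  neg y := by rw [hg.neg, hh.neg]; ring
  inv y hy := by rw [hg.inv y hy, hh.inv y hy]; ring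
  mul y h1 h2 := by rw [hg.mul y h1 h2, hh.mul y h1 h2]; ring

theorem laurentInt_eq_of_le (hg : ThetaLike p g) (n : ℤ) {r R : ℝ} (hr : ‖p‖ < r) (hrR : r ≤ R)
    (hR : ‖p‖ * R < 1) : laurentInt g n R = laurentInt g n r := by
  have hr0 : 0 < r := (norm_nonneg p).trans_lt hr
  have hd : ∀ z : ℂ, r ≤ ‖z‖ → ‖z‖ ≤ R → DifferentiableAt ℂ (fun z => g z * z ^ (-n)) z := by
    intro z h1 h2
    have hz : z ≠ 0 := norm_pos_iff.mp (hr0.trans_le h1)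
    exact (hg.differentiableAt z (hr.trans_le h1)
      ((mul_le_mul_of_nonneg_left h2 (norm_nonneg p)).trans_lt hR)).mul
      (differentiableAt_zpow.mpr (Or.inl hz))
  have key := circleIntegral_sub_center_inv_smul_eq_of_differentiable_on_annulus_off_countable
    (c := 0) (f := fun z => g z * z ^ (-n)) hr0 hrR Set.countable_empty
    (fun z hz => (hd z (by simpa using hz.2) (by simpa using hz.1)).continuousAt.continuousWithinAt)
    (fun z hz => hd z (by have := hz.1.2; simp at this; exact this.le)
      (by have := hz.1.1; simp at this; exact this.le))
  have conv : ∀ ρ : ℝ, 0 < ρ → (∮ z in C(0, ρ), (z - 0)⁻¹ • (g z * z ^ (-n))) =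
      I * laurentInt g n ρ := by
    intro ρ hρ
    rw [circleIntegral, laurentInt, ← intervalIntegral.integral_const_mul]
    refine intervalIntegral.integral_congr fun θ _ => ?_
    have : circleMap 0 ρ θ ≠ 0 := circleMap_ne_center hρ.ne'
    simp only [deriv_circleMap, smul_eq_mul, sub_zero]
    field_simp
  rw [conv R (hr0.trans_le hrR), conv r hr0] at key
  exact mul_left_cancel₀ I_ne_zero key

theorem laurentInt_eq (hg : ThetaLike p g) (n : ℤ) {r R : ℝ} (hr : ‖p‖ < r) (hr' : ‖p‖ * r < 1)
    (hR : ‖p‖ < R) (hR' : ‖p‖ * R < 1) : laurentInt g n R = laurentInt g n r := by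
  rcases le_total r R with h | h
  · exact laurentInt_eq_of_le hg n hr h hR'
  · exact (laurentInt_eq_of_le hg n hR h hr').symm

theorem exists_one_lt_mul_lt_one (hp : ‖p‖ < 1) : ∃ R : ℝ, 1 < R ∧ ‖p‖ * R < 1 := by
  have hpn := norm_nonneg p
  refine ⟨2 / (1 + ‖p‖), ?_, ?_⟩
  · rw [lt_div_iff₀ (by linarith)]; linarith
  · rw [← mul_div_assoc, div_lt_one (by linarith)]; linarith

theorem laurentInt_add_six (hp : ‖p‖ < 1) (hp0 : p ≠ 0) (hg : ThetaLike p g) (n : ℤ) :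
    laurentInt g (n + 6) 1 = p ^ n * laurentInt g n 1 := by
  obtain ⟨R, hR1, hR2⟩ := exists_one_lt_mul_lt_one hp
  have hpn : 0 < ‖p‖ := norm_pos_iff.mpr hp0
  have h1 : ‖p‖ * 1 < 1 := by rwa [mul_one]
  have e1 := laurentInt_eq hg (n + 6) (hp.trans hR1) hR2 hp h1
  have e2 := laurentInt_eq hg n (r := ‖p‖ * R) (by nlinarith) (by nlinarith) hp h1
  rw [e1, e2, laurentInt, laurentInt,
    ← integral_mul_circleMap (fun z => g z * z ^ (-n)), ← intervalIntegral.integral_const_mul]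
  refine intervalIntegral.integral_congr fun θ _ => ?_
  have hR0 : 0 < R := by linarith
  have hn : ‖circleMap 0 R θ‖ = R := by simp [abs_of_pos hR0]
  have hz : circleMap 0 R θ ≠ 0 := circleMap_ne_center hR0.ne'
  rw [hg.mul _ (by rw [hn]; exact hR1) (by rw [hn]; exact hR2), mul_zpow, zpow_neg, zpow_neg,
    zpow_neg, zpow_add₀ hz]
  have hpz := zpow_ne_zero n hp0
  have hzz := zpow_ne_zero n hz
  have : circleMap 0 R θ ^ (6 : ℤ) = circleMap 0 R θ ^ 6 := by norm_cast
  rw [this]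
  field_simp

theorem laurentInt_even (hg : ThetaLike p g) {n : ℤ} (hn : Even n) : laurentInt g n 1 = 0 := by
  have h := integral_mul_circleMap (fun z => g z * z ^ (-n)) (-1) 1
  simp only [norm_neg, norm_one, one_mul, neg_mul, hg.neg, hn.neg.neg_zpow] at h
  rw [intervalIntegral.integral_neg] at h
  have h' : laurentInt g n 1 = -laurentInt g n 1 := h.symm
  exact self_eq_neg.mp h'

theorem laurentInt_six_sub (hg : ThetaLike p g) (n : ℤ) :
    laurentInt g (6 - n) 1 = -laurentInt g n 1 := by
  rw [laurentInt, laurentInt, ← integral_inv_circleMap_one (fun z => g z * z ^ (-n)),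
    ← intervalIntegral.integral_neg]
  refine intervalIntegral.integral_congr fun θ _ => ?_
  have hz : circleMap 0 1 θ ≠ 0 := circleMap_ne_center one_ne_zero
  rw [hg.inv _ hz, neg_sub, zpow_sub₀ hz, inv_zpow', neg_neg]
  have : circleMap 0 1 θ ^ (6 : ℤ) = circleMap 0 1 θ ^ 6 := by norm_cast
  rw [this]
  ring

theorem laurentInt_eq_zero (hp : ‖p‖ < 1) (hp0 : p ≠ 0) (hg : ThetaLike p g)
    (h1 : laurentInt g 1 1 = 0) (n : ℤ) : laurentInt g n 1 = 0 := by
  have h3 : laurentInt g 3 1 = 0 := self_eq_neg.mp (laurentInt_six_sub hg 3)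
  have h5 : laurentInt g 5 1 = 0 := by
    have := laurentInt_six_sub hg 1
    rw [h1, neg_zero] at this
    exact this
  have hiff : ∀ n : ℤ, laurentInt g (n + 6) 1 = 0 ↔ laurentInt g n 1 = 0 := fun n => by
    rw [laurentInt_add_six hp hp0 hg, mul_eq_zero, or_iff_right (zpow_ne_zero n hp0)]
  have hper : Function.Periodic (fun n : ℤ => laurentInt g n 1 = 0) 6 := fun n =>
    propext (hiff n)
  have hmod : laurentInt g n 1 = 0 ↔ laurentInt g (n % 6) 1 = 0 := by
    have := hper.int_mul (n / 6) (n % 6)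
    simp only [Int.cast_id] at this
    rw [show n % 6 + n / 6 * 6 = n by omega] at this
    rw [this]
  rw [hmod]
  have hlt := Int.emod_lt_of_pos n (by norm_num : (0 : ℤ) < 6)
  have hge := Int.emod_nonneg n (by norm_num : (6 : ℤ) ≠ 0)
  generalize n % 6 = m at hlt hge
  interval_cases m
  · exact laurentInt_even hg (by decide)
  · exact h1
  · exact laurentInt_even hg (by decide)
  · exact h3
  · exact laurentInt_even hg (by decide)
  · exact h5

theorem eq_zero_of_laurentInt_eq_zero {R : ℝ} (hR : 0 < R)
    (hc : ∀ y : ℂ, ‖y‖ = R → ContinuousAt g y) (h0 : ∀ n : ℤ, laurentInt g n R = 0) {y : ℂ}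
    (hy : ‖y‖ = R) : g y = 0 := by
  have : Fact (0 < 2 * Real.pi) := ⟨Real.two_pi_pos⟩
  have hnorm : ∀ t : AddCircle (2 * Real.pi), ‖(R : ℂ) * (AddCircle.toCircle t : ℂ)‖ = R := by
    intro t
    rw [norm_mul, Circle.norm_coe, mul_one, norm_real, Real.norm_of_nonneg hR.le]
  let f : C(AddCircle (2 * Real.pi), ℂ) :=
    ⟨fun t => g (R * (AddCircle.toCircle t : ℂ)), by
      rw [continuous_iff_continuousAt]
      intro t
      exact (hc _ (hnorm t)).comp (f := fun t => (R : ℂ) * (AddCircle.toCircle t : ℂ))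
        (Continuous.continuousAt (continuous_const.mul
          (continuous_subtype_val.comp AddCircle.continuous_toCircle)))⟩
  have hcm : ∀ θ : ℝ, (R : ℂ) * (AddCircle.toCircle (θ : AddCircle (2 * Real.pi)) : ℂ) =
      circleMap 0 R θ := by
    intro θ
    rw [AddCircle.toCircle_apply_mk, circleMap_zero, Circle.coe_exp]
    congr 3
    field_simp
  have hcoef : fourierCoeff f = 0 := by
    ext n
    rw [fourierCoeff_eq_intervalIntegral f n 0, zero_add]
    have h1 : ∫ x in (0 : ℝ)..2 * Real.pi, fourier (-n) (x : AddCircle (2 * Real.pi)) • f x =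
        (R : ℂ) ^ n * laurentInt g n R := by
      rw [laurentInt, ← intervalIntegral.integral_const_mul]
      refine intervalIntegral.integral_congr fun θ _ => ?_
      have hf : f θ = g (circleMap 0 R θ) := by
        change g _ = _
        rw [hcm]
      have hR0 : (R : ℂ) ≠ 0 := by exact_mod_cast hR.ne'
      simp only [hf, fourier_apply, AddCircle.toCircle_zsmul, Circle.coe_inv, Circle.coe_zpow, smul_eq_mul,
        ← hcm, mul_zpow, zpow_neg]
      field_simp [zpow_ne_zero n hR0]
    rw [h1, h0]
    simp
  have hs := hasSum_fourier_series_of_summable (f := f) (by rw [hcoef]; exact summable_zero)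
  rw [hcoef] at hs
  simp only [Pi.zero_apply, zero_smul] at hs
  have hf0 : f = 0 := hs.unique hasSum_zero
  have hyc : y = circleMap 0 R (arg y) := by
    rw [circleMap_zero, ← hy, norm_mul_exp_arg_mul_I]
  rw [hyc, ← hcm]
  exact DFunLike.congr_fun hf0 _

/-- A `ThetaLike` function is determined by its first Laurent coefficient. -/
theorem ThetaLike.eq_zero (hp : ‖p‖ < 1) (hp0 : p ≠ 0) (hg : ThetaLike p g)
    (h1 : laurentInt g 1 1 = 0) {y : ℂ} (hy : ‖p‖ < ‖y‖) (hy' : ‖p‖ * ‖y‖ < 1) : g y = 0 := by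
  have hp1 : ‖p‖ * 1 < 1 := by rwa [mul_one]
  refine eq_zero_of_laurentInt_eq_zero (R := ‖y‖) ((norm_nonneg p).trans_lt hy) (fun z hz => ?_)
    (fun n => ?_) rfl
  · exact (hg.differentiableAt z (by rwa [hz]) (by rwa [hz])).continuousAt
  · rw [laurentInt_eq hg n hp hp1 hy hy']
    exact laurentInt_eq_zero hp hp0 hg h1 n

theorem ThetaLike.eq_zero_of_apply_eq_zero {h : ℂ → ℂ} (hp : ‖p‖ < 1) (hp0 : p ≠ 0)
    (hg : ThetaLike p g) (hh : ThetaLike p h) {w : ℂ} (hw : ‖w‖ = 1) (hgw : g w = 0)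
    (hhw : h w ≠ 0) {y : ℂ} (hy : ‖p‖ < ‖y‖) (hy' : ‖p‖ * ‖y‖ < 1) : g y = 0 := by
  have hintegrable : ∀ f, ThetaLike p f → IntervalIntegrable
      (fun θ => f (circleMap 0 1 θ) * circleMap 0 1 θ ^ (-1 : ℤ)) MeasureTheory.volume
      0 (2 * Real.pi) := by
    intro f hf
    refine Continuous.intervalIntegrable (continuous_iff_continuousAt.mpr fun θ => ?_) _ _
    have hz : circleMap 0 1 θ ≠ 0 := circleMap_ne_center one_ne_zero
    have hn : ‖circleMap 0 1 θ‖ = 1 := by simp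
    have hc := (continuous_circleMap 0 1).continuousAt (x := θ)
    exact ((hf.differentiableAt _ (by rwa [hn]) (by rwa [hn, mul_one])).continuousAt.comp
      (f := circleMap 0 1) hc).mul (hc.zpow₀ _ (Or.inl hz))
  set a := laurentInt h 1 1
  set b := laurentInt g 1 1 with hb
  have hcomb := hg.linearCombination hh a b
  have h0 : laurentInt (fun y => a * g y - b * h y) 1 1 = 0 := by
    have : laurentInt (fun y => a * g y - b * h y) 1 1 = a * b - b * a := by
      rw [laurentInt]
      simp only [sub_mul, mul_assoc]
      rw [intervalIntegral.integral_sub ((hintegrable g hg).const_mul a) ((hintegrable h hh).const_mul b),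
        intervalIntegral.integral_const_mul, intervalIntegral.integral_const_mul]
      rfl
    rw [this]; ring
  have hz := hcomb.eq_zero hp hp0 h0 (y := w) (by rwa [hw]) (by rwa [hw, mul_one])
  rw [hgw, mul_zero, zero_sub, neg_eq_zero, mul_eq_zero, or_iff_left hhw] at hz
  exact hg.eq_zero hp hp0 hz hy hy'

end LaurentUniqueness

section LambertExpansion

variable {p : ℂ}

theorem thetaLike_thetaNum (hp : ‖p‖ < 1) (hp0 : p ≠ 0) : ThetaLike p (thetaNum p) where
  differentiableAt _ h1 _ :=
    differentiableAt_thetaNum hp hp0 (norm_pos_iff.mp ((norm_nonneg p).trans_lt h1))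
  neg := thetaNum_neg
  inv _ hy := thetaNum_inv hp hp0 hy
  mul _ h1 _ := thetaNum_mul hp hp0 (norm_pos_iff.mp (zero_lt_one.trans h1))

theorem thetaLike_lamNum (hp : ‖p‖ < 1) (hp0 : p ≠ 0) : ThetaLike p (lamNum p) where
  differentiableAt _ h1 h2 := differentiableAt_lamNum hp h1 h2
  neg := lamNum_neg
  inv _ hy := lamNum_inv hp hy
  mul _ h1 h2 := lamNum_mul hp hp0 h1 h2

theorem qpoch_base_ne_zero (hp : ‖p‖ < 1) {k : ℕ} (hk : k ≠ 0) : qpoch (p ^ k) (p ^ k) ≠ 0 :=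
  qpoch_ne_zero_of_norm_lt_one (norm_pow_lt_one hp hk) (norm_pow_lt_one hp hk)

theorem lamNum_twelfth_root (hp : ‖p‖ < 1) {w : ℂ} (hw : w ^ 4 - w ^ 2 + 1 = 0) :
    lamNum p w = qpoch (p ^ 6) (p ^ 6) ^ 2 * (w * (1 - w ^ 4)) := by
  have h6 : w ^ 6 = -1 := by linear_combination (w ^ 2 + 1) * hw
  rw [lamNum, thetaDen_eq hp, thetaDenReg, h6]
  simp only [neg_neg, one_mul, div_one]
  ring

theorem thetaNum_twelfth_root (hp : ‖p‖ < 1) (hp0 : p ≠ 0) {w : ℂ} (hw : w ^ 4 - w ^ 2 + 1 = 0) :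
    thetaNum p w = C1 p * lamNum p w := by
  rw [lamNum_twelfth_root hp hw]
  have hp2 := norm_pow_lt_one hp two_ne_zero
  have hw0 : w ≠ 0 := by rintro rfl; simp at hw
  obtain ⟨ω, hω⟩ : ∃ ω, ω = w ^ 4 := ⟨_, rfl⟩
  have hω3 : ω ^ 2 + ω + 1 = 0 := by
    rw [hω]; linear_combination (w ^ 4 + w ^ 2 + 1) * hw
  have hζ : w ^ 2 = -ω ^ 2 := by
    rw [hω]; linear_combination (w ^ 2 * (w ^ 2 + 1)) * hw
  have hω0 : ω ≠ 0 := by rw [hω]; exact pow_ne_zero _ hw0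
  have hinv : ∀ x : ℂ, x / ω ^ 2 = ω * x := fun x => by
    field_simp
    linear_combination -(ω - 1) * x * hω3
  have e1 := qpoch_mul_qpoch_mul_qpoch hp2 hω3 (-p ^ 2)
  have e2 := qpoch_mul_qpoch_mul_qpoch hp2 hω3 (p ^ 2)
  have e3 := qpoch_mul_qpoch_mul_qpoch hp2 hω3 (-p)
  have k1 := qpoch_neg_odd_mul_neg_even hp
  have k2 := qpoch_neg_odd_mul_neg_even (norm_pow_lt_one hp three_ne_zero)
  have hP : qpoch p p ≠ 0 := by simpa using qpoch_base_ne_zero hp one_ne_zero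
  have hP2 := qpoch_base_ne_zero hp two_ne_zero
  have hP3 := qpoch_base_ne_zero hp three_ne_zero
  rw [show (-p ^ 2) ^ 3 = -p ^ 6 by ring, show (p ^ 2) ^ 3 = p ^ 6 by ring] at e1
  rw [show (p ^ 2) ^ 3 = p ^ 6 by ring] at e2
  rw [show (-p) ^ 3 = -p ^ 3 by ring, show (p ^ 2) ^ 3 = p ^ 6 by ring] at e3
  rw [show (p ^ 3) ^ 2 = p ^ 6 by ring] at k2
  have t1 : theta (w ^ 2) (p ^ 2) = (1 + ω ^ 2) *
      (qpoch (ω ^ 2 * -p ^ 2) (p ^ 2) * qpoch (ω * -p ^ 2) (p ^ 2)) := by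
    rw [theta_eq_mul hp2, hζ, div_neg, hinv]
    congr 3 <;> ring_nf
  have t2 : theta (-w ^ 2) (p ^ 2) = (1 - ω ^ 2) *
      (qpoch (ω ^ 2 * p ^ 2) (p ^ 2) * qpoch (ω * p ^ 2) (p ^ 2)) := by
    rw [theta_eq_mul hp2, hζ, neg_neg, hinv]
  have t3 : theta (p * w ^ 2) (p ^ 2) =
      qpoch (ω ^ 2 * -p) (p ^ 2) * qpoch (ω * -p) (p ^ 2) := by
    rw [theta, hζ]
    congr 2
    · ring
    · rw [show p ^ 2 / (p * -ω ^ 2) = -(p / ω ^ 2) by field_simp, hinv]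
      ring
  rw [thetaNum, t1, t2, t3, C1, ← hω]
  generalize qpoch (-p ^ 2) (p ^ 2) = b at *
  generalize qpoch (-p) (p ^ 2) = a at *
  generalize qpoch (-p ^ 3) (p ^ 6) = a' at *
  generalize qpoch (-p ^ 6) (p ^ 6) = b' at *
  generalize qpoch (p ^ 6) (p ^ 6) = c' at *
  generalize qpoch (p ^ 2) (p ^ 2) = c at *
  generalize qpoch (p ^ 3) (p ^ 3) = P' at *
  generalize qpoch p p = P at *
  generalize qpoch (ω ^ 2 * -p ^ 2) (p ^ 2) = x1 at *
  generalize qpoch (ω * -p ^ 2) (p ^ 2) = x2 at *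
  generalize qpoch (ω ^ 2 * p ^ 2) (p ^ 2) = x3 at *
  generalize qpoch (ω * p ^ 2) (p ^ 2) = x4 at *
  generalize qpoch (ω ^ 2 * -p) (p ^ 2) = x5 at *
  generalize qpoch (ω * -p) (p ^ 2) = x6 at *
  have hω4 : (1 + ω ^ 2) * (1 - ω ^ 2) = 1 - ω := by
    linear_combination (-ω ^ 2 + ω) * hω3
  have hprod : x1 * x2 * x3 * x4 * x5 * x6 * (a * b * c) = a' * b' * c' := by
    rw [← e1, ← e2, ← e3]; ring
  have hfin : x1 * x2 * x3 * x4 * x5 * x6 * (c ^ 2 * P') = P * c' ^ 2 := by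
    have : x1 * x2 * x3 * x4 * x5 * x6 * (c * (P * (a * b)) * P') =
        P * (P' * (a' * b')) * c' := by
      linear_combination P * P' * hprod
    rw [k1, k2] at this
    linear_combination this
  field_simp
  linear_combination (x1 * x2 * x3 * x4 * x5 * x6 * (c ^ 2 * P')) * hω4 + (1 - ω) * hfin

theorem exists_twelfth_root : ∃ w : ℂ, w ^ 4 - w ^ 2 + 1 = 0 ∧ ‖w‖ = 1 := by
  have h3 : ((Real.sqrt 3 : ℝ) : ℂ) ^ 2 = 3 := by
    rw [← ofReal_pow, Real.sq_sqrt (by norm_num)]; norm_num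
  have hw : (((Real.sqrt 3 : ℝ) + I) / 2 : ℂ) ^ 4 - (((Real.sqrt 3 : ℝ) + I) / 2) ^ 2 + 1 = 0 := by
    generalize ((Real.sqrt 3 : ℝ) : ℂ) = s at h3
    have hs : ((s + I) / 2) ^ 2 = (1 + s * I) / 2 := by
      linear_combination (1 / 4) * h3 + (1 / 4) * I_sq
    rw [show ((s + I) / 2) ^ 4 = (((s + I) / 2) ^ 2) ^ 2 by ring, hs]
    linear_combination (I ^ 2 / 4) * h3 + (3 / 4) * I_sq
  refine ⟨_, hw, ?_⟩
  generalize (((Real.sqrt 3 : ℝ) + I) / 2 : ℂ) = w at hw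
  have h6 : w ^ 6 = -1 := by linear_combination (w ^ 2 + 1) * hw
  have := congrArg norm h6
  rw [norm_pow, norm_neg, norm_one] at this
  exact (pow_eq_one_iff_of_nonneg (norm_nonneg w) (by norm_num)).mp this

/-- The theta quotient equals its Lambert expansion (in a form without denominators). -/
theorem thetaNum_eq (hp : ‖p‖ < 1) (hp0 : p ≠ 0) {y : ℂ} (hy : ‖p‖ < ‖y‖)
    (hy' : ‖p‖ * ‖y‖ < 1) : thetaNum p y = C1 p * lamNum p y := by
  obtain ⟨w, hw, hw1⟩ := exists_twelfth_root
  have hM := thetaLike_lamNum hp hp0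
  have hg := (thetaLike_thetaNum hp hp0).linearCombination hM 1 (C1 p)
  have hne : lamNum p w ≠ 0 := by
    rw [lamNum_twelfth_root hp hw]
    have h1 : w ≠ 0 := norm_pos_iff.mp (by rw [hw1]; exact one_pos)
    have h2 : 1 - w ^ 4 ≠ 0 := by
      intro h
      have h3 : w ^ 2 = 2 := by linear_combination -hw - h
      have : w ^ 4 = 4 := by rw [show w ^ 4 = (w ^ 2) ^ 2 by ring, h3]; norm_num
      rw [this] at h
      norm_num at h
    exact mul_ne_zero (pow_ne_zero _ (qpoch_base_ne_zero hp (by norm_num))) (mul_ne_zero h1 h2)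
  have := hg.eq_zero_of_apply_eq_zero hp hp0 hM hw1
    (by rw [thetaNum_twelfth_root hp hp0 hw]; ring) hne hy hy'
  linear_combination this

theorem thetaNum_div_thetaDen (hp : ‖p‖ < 1) (hp0 : p ≠ 0) {y : ℂ} (hy : ‖p‖ < ‖y‖)
    (hy' : ‖p‖ * ‖y‖ < 1) (hd : thetaDen p y ≠ 0) :
    thetaNum p y / thetaDen p y = C1 p * (y * (1 - y ^ 4) / (1 + y ^ 6) + lamSeries p y) := by
  rw [thetaNum_eq hp hp0 hy hy', lamNum]
  rw [thetaDen_eq hp] at hd ⊢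
  have h1 := left_ne_zero_of_mul hd
  have h2 := right_ne_zero_of_mul hd
  field_simp

theorem cos_ne_zero_of_norm_lt {z : ℂ} (hz : ‖z‖ < 3 / 2) : Complex.cos z ≠ 0 := by
  intro h
  obtain ⟨k, hk⟩ := Complex.cos_eq_zero_iff.mp h
  have h1 : ‖z‖ = |((2 * k + 1 : ℤ) : ℝ)| * (Real.pi / 2) := by
    rw [hk]
    have : ((2 * k + 1) * Real.pi / 2 : ℂ) = (((2 * k + 1 : ℤ) : ℝ) * (Real.pi / 2) : ℝ) := by
      push_cast; ring
    rw [this, norm_real, norm_mul, Real.norm_eq_abs, Real.norm_of_nonneg (by positivity)]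
  have h2 : (1 : ℝ) ≤ |((2 * k + 1 : ℤ) : ℝ)| := by
    rw [← Int.cast_abs]
    exact_mod_cast Int.one_le_abs (by omega)
  have h3 := Real.pi_gt_three
  nlinarith

/-- The generating function of the Glaisher numbers. -/
def glaisherFun (z : ℂ) : ℂ := Complex.sin (2 * z) / (2 * Complex.cos (3 * z))

theorem hasSum_glaisherFun {w : ℂ} (hw : ‖w‖ < 1 / 2) :
    HasSum (fun l : ℕ => (l.factorial : ℂ)⁻¹ * (w ^ l * iteratedDeriv l glaisherFun 0))
      (glaisherFun w) := by
  have hd : DifferentiableOn ℂ glaisherFun (Metric.ball 0 (1 / 2)) := by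
    intro z hz
    have hz' : ‖3 * z‖ < 3 / 2 := by
      rw [norm_mul]
      simp at hz ⊢
      linarith
    have := cos_ne_zero_of_norm_lt hz'
    exact DifferentiableAt.differentiableWithinAt (DifferentiableAt.div (by fun_prop)
      (by fun_prop) (by simpa using this))
  simpa using hasSum_taylorSeries_on_ball hd (z := w) (by simpa using hw)

theorem iteratedDeriv_glaisherFun_even {l : ℕ} (hl : Even l) :
    iteratedDeriv l glaisherFun 0 = 0 := by
  have h := iteratedDeriv_comp_neg l glaisherFun 0
  have h1 : (fun x => glaisherFun (-x)) = fun x => -glaisherFun x := by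
    ext x
    simp [glaisherFun, neg_div]
  rw [h1, iteratedDeriv_fun_neg, hl.neg_one_pow, one_smul, neg_zero] at h
  exact self_eq_neg.mp h.symm

/-- Taylor coefficients of the Lambert series in the variable `w`, where `y = exp (i w)`. -/
def lamTaylor (p : ℂ) (l : ℕ) : ℂ :=
  (∑' k : ℕ, lamCoeff p k * (2 * (k : ℂ) + 1) ^ l) * (I ^ l * (1 - (-1) ^ l) / l.factorial)

theorem hasSum_lamSeries (hp : ‖p‖ < 1) {w : ℂ} (hw : ‖p‖ * Real.exp ‖w‖ < 1) :
    HasSum (fun l : ℕ => lamTaylor p l * w ^ l) (lamSeries p (Complex.exp (I * w))) := by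
  set F : ℕ × ℕ → ℂ := fun q => lamCoeff p q.1 *
    (((2 * (q.1 : ℂ) + 1) * (I * w)) ^ q.2 / q.2.factorial -
      (-((2 * (q.1 : ℂ) + 1) * (I * w))) ^ q.2 / q.2.factorial) with hF
  have hexp : ∀ z : ℂ, HasSum (fun l : ℕ => z ^ l / l.factorial) (Complex.exp z) := fun z => by
    rw [Complex.exp_eq_exp_ℂ]
    exact NormedSpace.expSeries_div_hasSum_exp z
  have hrow : ∀ k : ℕ, HasSum (fun l => F (k, l)) (lamCoeff p k *
      (Complex.exp (I * w) ^ (2 * k + 1) - (Complex.exp (I * w))⁻¹ ^ (2 * k + 1))) := by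
    intro k
    have h1 : Complex.exp (I * w) ^ (2 * k + 1) =
        Complex.exp ((2 * (k : ℂ) + 1) * (I * w)) := by
      rw [← Complex.exp_nat_mul]
      push_cast
      rfl
    have h2 : (Complex.exp (I * w))⁻¹ ^ (2 * k + 1) =
        Complex.exp (-((2 * (k : ℂ) + 1) * (I * w))) := by
      rw [inv_pow, h1, Complex.exp_neg]
    rw [h1, h2]
    exact ((hexp ((2 * (k : ℂ) + 1) * (I * w))).sub
      (hexp (-((2 * (k : ℂ) + 1) * (I * w))))).mul_left (lamCoeff p k)
  have hexpR : ∀ x : ℝ, HasSum (fun l : ℕ => x ^ l / l.factorial) (Real.exp x) := fun x => by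
    rw [Real.exp_eq_exp_ℝ]
    exact NormedSpace.expSeries_div_hasSum_exp x
  have hbound : ∀ q : ℕ × ℕ, ‖F q‖ ≤
      ‖lamCoeff p q.1‖ * (2 * (((2 * q.1 + 1 : ℕ) * ‖w‖) ^ q.2 / q.2.factorial)) := by
    intro q
    rw [norm_mul]
    gcongr
    refine (norm_sub_le _ _).trans_eq ?_
    have : ‖(2 * (q.1 : ℂ) + 1)‖ = ((2 * q.1 + 1 : ℕ) : ℝ) := by
      rw [← Complex.norm_natCast]; push_cast; rfl
    simp only [norm_div, norm_pow, norm_neg, norm_mul, norm_I, one_mul, Complex.norm_natCast, this]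
    ring
  have hsum : Summable F := by
    refine Summable.of_norm_bounded ?_ hbound
    rw [summable_prod_of_nonneg fun q => by positivity]
    constructor
    · intro k
      exact ((hexpR ((2 * k + 1 : ℕ) * ‖w‖)).summable.mul_left 2).mul_left ‖lamCoeff p k‖
    · have h1 : ∀ k : ℕ, ∑' l : ℕ, ‖lamCoeff p k‖ *
          (2 * (((2 * k + 1 : ℕ) * ‖w‖) ^ l / l.factorial)) =
          ‖lamCoeff p k‖ * (2 * Real.exp ‖w‖ ^ (2 * k + 1)) := by
        intro k
        rw [(((hexpR _).mul_left 2).mul_left _).tsum_eq, ← Real.exp_nat_mul]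
      simp only [h1]
      refine Summable.of_nonneg_of_le (fun k => by positivity) (fun k => ?_)
        ((summable_pow_odd (by positivity) hw).mul_left ((1 - ‖p‖)⁻¹ * 2))
      calc _ ≤ ((1 - ‖p‖)⁻¹ * ‖p‖ ^ (2 * k + 1)) * (2 * Real.exp ‖w‖ ^ (2 * k + 1)) := by
            gcongr
            exact norm_lamCoeff_le hp k
        _ = _ := by rw [mul_pow]; ring
  have hcol : ∀ l : ℕ, ∑' k : ℕ, F (k, l) = lamTaylor p l * w ^ l := by
    intro l
    rw [lamTaylor, mul_assoc, ← tsum_mul_right]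
    refine tsum_congr fun k => ?_
    simp only [F]
    rw [neg_pow ((2 * (k : ℂ) + 1) * (I * w)), mul_pow, mul_pow]
    ring
  have hS : ∑' q, F q = lamSeries p (Complex.exp (I * w)) := by
    rw [hsum.tsum_prod' fun k => (hrow k).summable, lamSeries]
    exact tsum_congr fun k => (hrow k).tsum_eq
  have := hsum.prod_symm.hasSum.prod_fiberwise fun l => (hsum.prod_symm.prod_factor l).hasSum
  have hswap : ∑' q : ℕ × ℕ, F q.swap = ∑' q, F q :=
    (Equiv.prodComm ℕ ℕ).tsum_eq F
  rw [hswap, hS] at this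
  simpa only [Prod.swap_prod_mk, hcol] using this

/-- The theta quotient as a function of an additive variable. -/
def thetaQuot (p u : ℂ) : ℂ :=
  thetaNum p (Complex.exp (Real.pi * I * u)) / thetaDen p (Complex.exp (Real.pi * I * u))

/-- Taylor coefficients of `thetaQuot`. -/
def quotTaylor (p : ℂ) (l : ℕ) : ℂ :=
  C1 p * (Real.pi : ℂ) ^ l *
    (-2 * I * ((l.factorial : ℂ)⁻¹ * iteratedDeriv l glaisherFun 0) + lamTaylor p l)

theorem exp_mul_div_eq_glaisherFun {w : ℂ} (hc : Complex.cos (3 * w) ≠ 0) :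
    Complex.exp (I * w) * (1 - Complex.exp (I * w) ^ 4) / (1 + Complex.exp (I * w) ^ 6) =
      -2 * I * glaisherFun w := by
  have hy := Complex.exp_ne_zero (I * w)
  have hs : Complex.sin (2 * w) = ((Complex.exp (I * w))⁻¹ ^ 2 - Complex.exp (I * w) ^ 2) * I / 2 := by
    rw [Complex.sin, ← Complex.exp_neg, ← Complex.exp_nat_mul, ← Complex.exp_nat_mul]
    congr 4 <;> (push_cast; ring_nf)
  have hcos : Complex.cos (3 * w) = (Complex.exp (I * w) ^ 3 + (Complex.exp (I * w))⁻¹ ^ 3) / 2 := by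
    rw [Complex.cos, ← Complex.exp_neg, ← Complex.exp_nat_mul, ← Complex.exp_nat_mul]
    congr 3 <;> (push_cast; ring_nf)
  rw [glaisherFun, hs]
  rw [hcos] at hc ⊢
  generalize Complex.exp (I * w) = y at *
  have h6 : 1 + y ^ 6 ≠ 0 := by
    intro h
    apply hc
    field_simp
    linear_combination h
  have h6' : y ^ 6 + 1 ≠ 0 := by rwa [add_comm]
  have : y ^ 3 + y⁻¹ ^ 3 = (1 + y ^ 6) / y ^ 3 := by field_simp; ring
  rw [this]
  field_simp
  linear_combination (1 - y ^ 4) * I_sq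

theorem exists_hasSum_thetaQuot (hp : ‖p‖ < 1) (hp0 : p ≠ 0) : ∃ ρ : ℝ, 0 < ρ ∧ ∀ u : ℂ, ‖u‖ < ρ →
    HasSum (fun l : ℕ => quotTaylor p l * u ^ l) (thetaQuot p u) := by
  have hpn : 0 < ‖p‖ := norm_pos_iff.mpr hp0
  have hy1 : Filter.Tendsto (fun u : ℂ => Complex.exp (Real.pi * I * u)) (nhds 0) (nhds 1) := by
    have : Continuous fun u : ℂ => Complex.exp (Real.pi * I * u) := by fun_prop
    simpa using this.tendsto 0
  have hw1 : Filter.Tendsto (fun u : ℂ => ‖Real.pi * u‖) (nhds 0) (nhds 0) := by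
    have : Continuous fun u : ℂ => ‖Real.pi * u‖ := by fun_prop
    simpa using this.tendsto 0
  have e1 : ∀ᶠ u : ℂ in nhds 0, ‖p‖ < ‖Complex.exp (Real.pi * I * u)‖ :=
    hy1.norm.eventually_const_lt (by simpa using hp)
  have e2 : ∀ᶠ u : ℂ in nhds 0, ‖p‖ * ‖Complex.exp (Real.pi * I * u)‖ < 1 :=
    (hy1.norm.const_mul ‖p‖).eventually_lt_const (by simpa using hp)
  have hden1 : thetaDen p 1 ≠ 0 := by
    have hp6 := norm_pow_lt_one hp (by norm_num : 6 ≠ 0)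
    rw [thetaDen_eq hp, thetaDenReg]
    refine mul_ne_zero (by norm_num) (mul_ne_zero ?_ ?_) <;>
    · refine qpoch_ne_zero_of_norm_lt_one hp6 ?_
      simpa using hp6
  have e3 : ∀ᶠ u : ℂ in nhds 0, thetaDen p (Complex.exp (Real.pi * I * u)) ≠ 0 :=
    ((differentiableAt_thetaDen hp one_ne_zero).continuousAt.tendsto.comp hy1).eventually_ne hden1
  have e4 : ∀ᶠ u : ℂ in nhds 0, ‖Real.pi * u‖ < 1 / 2 := hw1.eventually_lt_const (by norm_num)
  have e5 : ∀ᶠ u : ℂ in nhds 0, ‖p‖ * Real.exp ‖Real.pi * u‖ < 1 := by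
    have h := (((Real.continuous_exp.tendsto 0).comp hw1).const_mul ‖p‖)
    exact h.eventually_lt_const (by simpa using hp)
  obtain ⟨ρ, hρ, H⟩ := Metric.eventually_nhds_iff.mp (e1.and (e2.and (e3.and (e4.and e5))))
  refine ⟨ρ, hρ, fun u hu => ?_⟩
  obtain ⟨h1, h2, h3, h4, h5⟩ := H (y := u) (by simpa using hu)
  have hcos : Complex.cos (3 * (Real.pi * u)) ≠ 0 := cos_ne_zero_of_norm_lt (by
    rw [norm_mul, show ‖(3 : ℂ)‖ = 3 by simp]; linarith)
  have he : Complex.exp (Real.pi * I * u) = Complex.exp (I * (Real.pi * u)) := by ring_nf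
  have hval : thetaQuot p u = C1 p * (-2 * I * glaisherFun (Real.pi * u) +
      lamSeries p (Complex.exp (I * (Real.pi * u)))) := by
    rw [thetaQuot, thetaNum_div_thetaDen hp hp0 h1 h2 h3, he, exp_mul_div_eq_glaisherFun hcos]
  rw [hval]
  refine ((((hasSum_glaisherFun h4).mul_left (-2 * I)).add
    (hasSum_lamSeries hp h5)).mul_left (C1 p)).congr_fun ?_
  intro l
  rw [quotTaylor, mul_pow]
  ring

theorem quotTaylor_even {l : ℕ} (hl : Even l) : quotTaylor p l = 0 := by
  rw [quotTaylor, iteratedDeriv_glaisherFun_even hl, lamTaylor, hl.neg_one_pow]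
  ring

theorem quotTaylor_odd (j : ℕ) : quotTaylor p (2 * j + 1) =
    2 * I * C1 p * Real.pi ^ (2 * j + 1) * (-1) ^ j / (2 * j + 1).factorial * L1 p j := by
  have hodd : (-1 : ℂ) ^ (2 * j + 1) = -1 := (odd_two_mul_add_one j).neg_one_pow
  have hI : I ^ (2 * j + 1) = (-1) ^ j * I := by rw [pow_succ, pow_mul, I_sq]
  have hg : iteratedDeriv (2 * j + 1) glaisherFun 0 = glaisherT j := rfl
  have hL : L1 p j = (-1) ^ (j + 1) * glaisherT j +
      ∑' k : ℕ, lamCoeff p k * (2 * (k : ℂ) + 1) ^ (2 * j + 1) := rfl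
  have hj : ((-1 : ℂ) ^ j) ^ 2 = 1 := by rw [← pow_mul, mul_comm, pow_mul]; simp
  rw [quotTaylor, lamTaylor, hodd, hI, hg, hL, pow_succ (-1 : ℂ) j]
  generalize (-1 : ℂ) ^ j = s at hj
  linear_combination (2 * I * C1 p * Real.pi ^ (2 * j + 1) / (2 * j + 1).factorial * glaisherT j) * hj

end LambertExpansion

section Pfaffian

/-- The pairing of the indices `2 j` and `2 j + 1`. -/
def pairEquiv (m : ℕ) : Fin m × Fin 2 ≃ Fin (2 * m) :=
  finProdFinEquiv.trans (finCongr (mul_comm m 2))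

theorem pairEquiv_val {m : ℕ} (q : Fin m × Fin 2) : (pairEquiv m q : ℕ) = 2 * q.1 + q.2 := by
  simp [pairEquiv, finProdFinEquiv, add_comm]

theorem pf_eq {m : ℕ} (A : Matrix (Fin (2 * m)) (Fin (2 * m)) ℂ) :
    pf A = (1 / (2 ^ m * (Nat.factorial m) : ℂ)) *
      ∑ σ : Equiv.Perm (Fin (2 * m)), ((Equiv.Perm.sign σ : ℤ) : ℂ) *
        ∏ j : Fin m, A (σ (pairEquiv m (j, 0))) (σ (pairEquiv m (j, 1))) := by
  have h0 : ∀ j : Fin m, pairEquiv m (j, 0) = ⟨2 * (j : ℕ), by have := j.isLt; omega⟩ :=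
    fun j => Fin.ext (by simp [pairEquiv_val])
  have h1 : ∀ j : Fin m, pairEquiv m (j, 1) = ⟨2 * (j : ℕ) + 1, by have := j.isLt; omega⟩ :=
    fun j => Fin.ext (by simp [pairEquiv_val])
  simp only [h0, h1, pf]

theorem prod_pairEquiv {m : ℕ} (g : Fin (2 * m) → ℂ) :
    ∏ a, g a = ∏ j : Fin m, g (pairEquiv m (j, 0)) * g (pairEquiv m (j, 1)) := by
  rw [← (pairEquiv m).prod_comp, Fintype.prod_prod_type]
  simp [Fin.prod_univ_two]

/-- A function on `Fin (2 * m)` amounts to the family of its values on pairs. -/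
def pairFunEquiv (m : ℕ) (α : Type) : (Fin (2 * m) → α) ≃ (Fin m → α × α) where
  toFun f j := (f (pairEquiv m (j, 0)), f (pairEquiv m (j, 1)))
  invFun g a := if ((pairEquiv m).symm a).2 = 0 then (g ((pairEquiv m).symm a).1).1
    else (g ((pairEquiv m).symm a).1).2
  left_inv f := by
    ext a
    obtain ⟨⟨j, b⟩, rfl⟩ := (pairEquiv m).surjective a
    fin_cases b <;> simp
  right_inv g := by
    ext j <;> simp

theorem sum_fun_eq_sum_perm {ι : Type*} [Fintype ι] [DecidableEq ι] (g : (ι → ι) → ℂ)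
    (hg : ∀ f, ¬ Function.Injective f → g f = 0) :
    ∑ f, g f = ∑ σ : Equiv.Perm ι, g σ := by
  refine (Finset.sum_of_injOn (fun σ : Equiv.Perm ι => (σ : ι → ι))
    (DFunLike.coe_injective.injOn) (fun _ _ => Finset.mem_coe.mpr (Finset.mem_univ _))
    (fun f _ hf => hg f fun hinj => hf ?_) fun _ _ => rfl).symm
  exact ⟨Equiv.ofBijective f (Finite.injective_iff_bijective.mp hinj), by simp, rfl⟩

theorem pf_mul_mul_transpose {m : ℕ} (W Q : Matrix (Fin (2 * m)) (Fin (2 * m)) ℂ) :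
    pf (W * Q * W.transpose) = W.det * pf Q := by
  have key : ∑ σ : Equiv.Perm (Fin (2 * m)), ((Equiv.Perm.sign σ : ℤ) : ℂ) *
      ∏ j : Fin m, (W * Q * W.transpose) (σ (pairEquiv m (j, 0))) (σ (pairEquiv m (j, 1))) =
      ∑ f : Fin (2 * m) → Fin (2 * m),
        (∏ j : Fin m, Q (f (pairEquiv m (j, 0))) (f (pairEquiv m (j, 1)))) *
          (W.submatrix id f).det := by
    have hentry : ∀ a b, (W * Q * W.transpose) a b =
        ∑ q : Fin (2 * m) × Fin (2 * m), W a q.1 * Q q.1 q.2 * W b q.2 := by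
      intro a b
      rw [Fintype.sum_prod_type_right]
      simp only [Matrix.mul_apply, Matrix.transpose_apply, Finset.sum_mul]
    simp only [hentry, Finset.prod_univ_sum, Fintype.piFinset_univ, Finset.mul_sum]
    rw [Finset.sum_comm, ← (pairFunEquiv m (Fin (2 * m))).sum_comp]
    refine Finset.sum_congr rfl fun f _ => ?_
    rw [Matrix.det_apply', Finset.mul_sum]
    refine Finset.sum_congr rfl fun σ _ => ?_
    rw [prod_pairEquiv]
    simp only [pairFunEquiv, Equiv.coe_fn_mk, Matrix.submatrix_apply, id, Finset.prod_mul_distrib]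
    ring
  rw [pf_eq, key, pf_eq, mul_left_comm, sum_fun_eq_sum_perm]
  · rw [Finset.mul_sum (a := W.det)]
    congr 1
    refine Finset.sum_congr rfl fun σ _ => ?_
    rw [Matrix.det_permute']
    ring
  · intro f hf
    simp only [Function.Injective, not_forall] at hf
    obtain ⟨a, b, hab, hne⟩ := hf
    rw [Matrix.det_zero_of_column_eq hne fun i => by simp [hab], mul_zero]

/-- The standard symplectic matrix on the index pairs. -/
def pairForm (m : ℕ) : Matrix (Fin (2 * m)) (Fin (2 * m)) ℂ :=
  Matrix.of fun a b => if ((pairEquiv m).symm a).1 = ((pairEquiv m).symm b).1 then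
    !![0, 1; -1, 0] ((pairEquiv m).symm a).2 ((pairEquiv m).symm b).2 else 0

theorem pairForm_apply {m : ℕ} (q r : Fin m × Fin 2) :
    pairForm m (pairEquiv m q) (pairEquiv m r) =
      if q.1 = r.1 then (!![0, 1; -1, 0] : Matrix (Fin 2) (Fin 2) ℂ) q.2 r.2 else 0 := by
  simp [pairForm]

/-- The permutation of the index pairs given by `π`, twisted by `ε` inside the pairs. -/
def pairPerm {m : ℕ} (q : Equiv.Perm (Fin m) × (Fin m → Equiv.Perm (Fin 2))) :
    Equiv.Perm (Fin (2 * m)) :=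
  (pairEquiv m).permCongr (Equiv.prodShear q.1 q.2)

theorem pairPerm_apply {m : ℕ} (q : Equiv.Perm (Fin m) × (Fin m → Equiv.Perm (Fin 2)))
    (r : Fin m × Fin 2) : pairPerm q (pairEquiv m r) = pairEquiv m (q.1 r.1, q.2 r.1 r.2) := by
  simp [pairPerm]

theorem sign_pairPerm {m : ℕ} (q : Equiv.Perm (Fin m) × (Fin m → Equiv.Perm (Fin 2))) :
    Equiv.Perm.sign (pairPerm q) = ∏ j, Equiv.Perm.sign (q.2 j) := by
  have h : (Equiv.prodShear q.1 q.2 : Equiv.Perm (Fin m × Fin 2)) =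
      (Equiv.prodCongrLeft fun _ : Fin 2 => q.1) * Equiv.prodCongrRight q.2 := by
    ext r <;> simp
  rw [pairPerm, Equiv.Perm.sign_permCongr, h, Equiv.Perm.sign_mul, Equiv.Perm.sign_prodCongrLeft,
    Equiv.Perm.sign_prodCongrRight]
  simp

theorem pairPerm_injective {m : ℕ} : Function.Injective (pairPerm (m := m)) := by
  intro q r h
  have h' : ∀ j b, (q.1 j, q.2 j b) = (r.1 j, r.2 j b) := by
    intro j b
    have := congrArg (fun σ => σ (pairEquiv m (j, b))) h
    simpa only [pairPerm_apply, (pairEquiv m).injective.eq_iff] using this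
  ext j b
  · exact congrArg Fin.val (congrArg Prod.fst (h' j 0))
  · exact congrArg Fin.val (congrArg Prod.snd (h' j b))

theorem mem_range_pairPerm {m : ℕ} (σ : Equiv.Perm (Fin (2 * m)))
    (h : ∀ j : Fin m, pairForm m (σ (pairEquiv m (j, 0))) (σ (pairEquiv m (j, 1))) ≠ 0) :
    ∃ q, pairPerm q = σ := by
  let s : Fin m × Fin 2 → Fin m × Fin 2 := fun r => (pairEquiv m).symm (σ (pairEquiv m r))
  have hs : Function.Injective s :=
    (pairEquiv m).symm.injective.comp (σ.injective.comp (pairEquiv m).injective)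
  have hs1 : ∀ j, (s (j, 1)).1 = (s (j, 0)).1 := by
    intro j
    by_contra hne
    apply h j
    rw [pairForm, Matrix.of_apply, if_neg (Ne.symm hne)]
  have hs2 : ∀ j b, (s (j, b)).1 = (s (j, 0)).1 := by
    intro j b
    fin_cases b
    · rfl
    · exact hs1 j
  have hε : ∀ j, Function.Injective fun b => (s (j, b)).2 := by
    intro j b c hbc
    have := hs (Prod.ext ((hs2 j b).trans (hs2 j c).symm) hbc)
    exact congrArg Prod.snd this
  have hπ : Function.Surjective fun j => (s (j, 0)).1 := by
    intro i
    obtain ⟨⟨j, b⟩, hj⟩ := (Finite.injective_iff_surjective.mp hs) (i, 0)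
    exact ⟨j, (hs2 j b).symm.trans (congrArg Prod.fst hj)⟩
  refine ⟨(Equiv.ofBijective _ (Finite.surjective_iff_bijective.mp hπ),
    fun j => Equiv.ofBijective _ (Finite.injective_iff_bijective.mp (hε j))), ?_⟩
  ext1 a
  obtain ⟨⟨j, b⟩, rfl⟩ := (pairEquiv m).surjective a
  rw [pairPerm_apply, ← Equiv.eq_symm_apply]
  exact Prod.ext (hs2 j b).symm rfl

theorem pf_pairForm (m : ℕ) : pf (pairForm m) = 1 := by
  have hterm : ∀ q : Equiv.Perm (Fin m) × (Fin m → Equiv.Perm (Fin 2)), (1 : ℂ) =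
      ((Equiv.Perm.sign (pairPerm q) : ℤ) : ℂ) * ∏ j : Fin m,
        pairForm m (pairPerm q (pairEquiv m (j, 0))) (pairPerm q (pairEquiv m (j, 1))) := by
    intro q
    have h2 : ∀ ε : Equiv.Perm (Fin 2), ((Equiv.Perm.sign ε : ℤ) : ℂ) *
        (!![0, 1; -1, 0] : Matrix (Fin 2) (Fin 2) ℂ) (ε 0) (ε 1) = 1 := by
      intro ε
      have hε : ε = 1 ∨ ε = Equiv.swap 0 1 := by revert ε; decide
      rcases hε with rfl | rfl
      · simp
      · simp
    rw [sign_pairPerm, Units.coe_prod, Int.cast_prod, ← Finset.prod_mul_distrib]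
    simp only [pairPerm_apply, pairForm_apply, if_true, h2, Finset.prod_const_one]
  have hsum : ∑ _q : Equiv.Perm (Fin m) × (Fin m → Equiv.Perm (Fin 2)), (1 : ℂ) =
      ∑ σ : Equiv.Perm (Fin (2 * m)), ((Equiv.Perm.sign σ : ℤ) : ℂ) * ∏ j : Fin m,
        pairForm m (σ (pairEquiv m (j, 0))) (σ (pairEquiv m (j, 1))) := by
    refine Finset.sum_of_injOn pairPerm pairPerm_injective.injOn
      (fun _ _ => Finset.mem_coe.mpr (Finset.mem_univ _)) (fun σ _ hσ => ?_) fun q _ => hterm q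
    by_contra hne
    refine hσ ?_
    obtain ⟨q, hq⟩ := mem_range_pairPerm σ fun j hj =>
      hne (mul_eq_zero_of_right _ (Finset.prod_eq_zero (Finset.mem_univ j) hj))
    exact ⟨q, by simp, hq⟩
  rw [pf_eq, ← hsum]
  simp only [Finset.sum_const, Finset.card_univ, Fintype.card_prod, Fintype.card_perm,
    Fintype.card_fin, Fintype.card_fun, nsmul_eq_mul, mul_one]
  have : (m.factorial : ℂ) ≠ 0 := by exact_mod_cast m.factorial_ne_zero
  push_cast [Nat.factorial]
  field_simp

/-- The pfaffian of a skew matrix which only pairs indices of opposite parity. -/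
theorem pf_eq_det_of_bipartite {m : ℕ} (B : Matrix (Fin (2 * m)) (Fin (2 * m)) ℂ)
    (hskew : ∀ a b, B b a = -B a b)
    (hB : ∀ (b : Fin 2) (i j : Fin m), B (pairEquiv m (i, b)) (pairEquiv m (j, b)) = 0) :
    pf B = Matrix.det
      (Matrix.of fun i j : Fin m => B (pairEquiv m (i, 0)) (pairEquiv m (j, 1))) := by
  set M := Matrix.of fun i j : Fin m => B (pairEquiv m (i, 0)) (pairEquiv m (j, 1)) with hM
  set U := Matrix.reindex (pairEquiv m) (pairEquiv m) (Matrix.blockDiagonal ![M, 1]) with hU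
  have hdet : U.det = M.det := by
    rw [hU, Matrix.det_reindex_self, Matrix.det_blockDiagonal, Fin.prod_univ_two]
    simp
  have hBU : B = U * pairForm m * U.transpose := by
    ext a a'
    obtain ⟨⟨i, b⟩, rfl⟩ := (pairEquiv m).surjective a
    obtain ⟨⟨j, c⟩, rfl⟩ := (pairEquiv m).surjective a'
    simp only [Matrix.mul_apply, Matrix.transpose_apply]
    simp only [← (pairEquiv m).sum_comp, pairForm_apply, hU, Matrix.reindex_apply,
      Matrix.submatrix_apply, Equiv.symm_apply_apply, Fintype.sum_prod_type, Fin.sum_univ_two,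
      Matrix.blockDiagonal_apply]
    fin_cases b <;> fin_cases c
    · simpa using hB 0 i j
    · simp [Matrix.one_apply, hM]
    · simpa [Matrix.one_apply, hM] using hskew (pairEquiv m (j, 0)) (pairEquiv m (i, 1))
    · simpa using hB 1 i j
  rw [← hdet, ← mul_one U.det, ← pf_pairForm m, ← pf_mul_mul_transpose, ← hBU]

end Pfaffian

section NewtonBasis

/-- The index shift `a ↦ (0, a 0, a 1, …)`. -/
def shiftSeq (a : ℕ → ℂ) : ℕ → ℂ
  | 0 => 0
  | k + 1 => a k

/-- The Newton polynomials `∏ i < k, (x - z i)`. -/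
def newtonPoly (z : ℕ → ℂ) (k : ℕ) (x : ℂ) : ℂ := ∏ i ∈ Finset.range k, (x - z i)

/-- The coefficients of `(x - y) ^ m` in products of Newton polynomials in `x` and `y`. -/
def newtonCoeff (z : ℕ → ℂ) : ℕ → ℕ → ℕ → ℂ
  | 0, k, l => if k = 0 ∧ l = 0 then 1 else 0
  | m + 1, k, l => (z k - z l) * newtonCoeff z m k l +
      shiftSeq (fun k' => newtonCoeff z m k' l) k - shiftSeq (fun l' => newtonCoeff z m k l') l

variable {z : ℕ → ℂ}

theorem sum_newtonPoly_mul (N : ℕ) (x : ℂ) (a : ℕ → ℂ) :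
    ∑ k ∈ Finset.range N, newtonPoly z k x * (z k * a k + shiftSeq a k) =
      x * ∑ k ∈ Finset.range N, newtonPoly z k x * a k - newtonPoly z N x * shiftSeq a N := by
  induction N with
  | zero => simp [shiftSeq]
  | succ N ih =>
    rw [Finset.sum_range_succ, ih, Finset.sum_range_succ]
    simp only [newtonPoly, Finset.prod_range_succ, shiftSeq]
    ring

theorem sum_newtonCoeff {N : ℕ} (hN : 0 < N) {x y : ℂ} (hx : newtonPoly z N x = 0)
    (hy : newtonPoly z N y = 0) (m : ℕ) :
    ∑ k ∈ Finset.range N, ∑ l ∈ Finset.range N,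
      newtonPoly z k x * newtonCoeff z m k l * newtonPoly z l y = (x - y) ^ m := by
  induction m with
  | zero =>
    rw [Finset.sum_eq_single_of_mem 0 (by simpa), Finset.sum_eq_single_of_mem 0 (by simpa)]
    · simp [newtonCoeff, newtonPoly]
    · intro l _ hl
      simp [newtonCoeff, hl]
    · intro k _ hk
      simp [newtonCoeff, hk]
  | succ m ih =>
    have e1 : ∑ k ∈ Finset.range N, ∑ l ∈ Finset.range N, newtonPoly z k x *
        (z k * newtonCoeff z m k l + shiftSeq (fun k' => newtonCoeff z m k' l) k) *
          newtonPoly z l y = x * (x - y) ^ m := by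
      rw [← ih, Finset.sum_comm]
      conv_rhs => rw [Finset.sum_comm, Finset.mul_sum]
      refine Finset.sum_congr rfl fun l _ => ?_
      rw [← Finset.sum_mul, sum_newtonPoly_mul N x fun k => newtonCoeff z m k l, hx,
        ← Finset.sum_mul]
      ring
    have e2 : ∑ k ∈ Finset.range N, ∑ l ∈ Finset.range N, newtonPoly z k x *
        (z l * newtonCoeff z m k l + shiftSeq (fun l' => newtonCoeff z m k l') l) *
          newtonPoly z l y = y * (x - y) ^ m := by
      rw [← ih, Finset.mul_sum]
      refine Finset.sum_congr rfl fun k _ => ?_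
      calc _ = newtonPoly z k x * ∑ l ∈ Finset.range N, newtonPoly z l y *
            (z l * newtonCoeff z m k l + shiftSeq (fun l' => newtonCoeff z m k l') l) := by
            rw [Finset.mul_sum]
            exact Finset.sum_congr rfl fun l _ => by ring
        _ = _ := by
            rw [sum_newtonPoly_mul N y fun l => newtonCoeff z m k l, hy, Finset.mul_sum,
              Finset.mul_sum, zero_mul, sub_zero, Finset.mul_sum]
            exact Finset.sum_congr rfl fun l _ => by ring
    rw [pow_succ', sub_mul, ← e1, ← e2, ← Finset.sum_sub_distrib]
    refine Finset.sum_congr rfl fun k _ => ?_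
    rw [← Finset.sum_sub_distrib]
    refine Finset.sum_congr rfl fun l _ => ?_
    rw [newtonCoeff]
    ring

theorem continuous_newtonCoeff (m k l : ℕ) :
    Continuous fun z : ℕ → ℂ => newtonCoeff z m k l := by
  induction m generalizing k l with
  | zero => simpa only [newtonCoeff] using continuous_const
  | succ m ih =>
    have h1 : Continuous fun z : ℕ → ℂ => shiftSeq (fun k' => newtonCoeff z m k' l) k := by
      cases k with
      | zero => exact continuous_const
      | succ k => exact ih k l
    have h2 : Continuous fun z : ℕ → ℂ => shiftSeq (fun l' => newtonCoeff z m k l') l := by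
      cases l with
      | zero => exact continuous_const
      | succ l => exact ih k l
    simp only [newtonCoeff]
    have := ih k l
    fun_prop

theorem norm_newtonCoeff_le {s : ℝ} (hs : 0 < s) (hz : ∀ k, ‖z k‖ ≤ s) (m k l : ℕ) :
    ‖newtonCoeff z m k l‖ ≤ (s ^ (k + l))⁻¹ * (4 * s) ^ m := by
  induction m generalizing k l with
  | zero =>
    rw [newtonCoeff]
    split_ifs with h
    · simp [h.1, h.2]
    · rw [norm_zero]
      positivity
  | succ m ih =>
    have h1 : ‖shiftSeq (fun k' => newtonCoeff z m k' l) k‖ ≤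
        s * ((s ^ (k + l))⁻¹ * (4 * s) ^ m) := by
      cases k with
      | zero =>
        rw [shiftSeq, norm_zero]
        positivity
      | succ k =>
        refine (ih k l).trans_eq ?_
        rw [show k + 1 + l = k + l + 1 by ring, pow_succ]
        field_simp
    have h2 : ‖shiftSeq (fun l' => newtonCoeff z m k l') l‖ ≤
        s * ((s ^ (k + l))⁻¹ * (4 * s) ^ m) := by
      cases l with
      | zero =>
        rw [shiftSeq, norm_zero]
        positivity
      | succ l =>
        refine (ih k l).trans_eq ?_
        rw [← add_assoc, pow_succ]
        field_simp
    have h0 : ‖(z k - z l) * newtonCoeff z m k l‖ ≤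
        (s + s) * ((s ^ (k + l))⁻¹ * (4 * s) ^ m) := by
      rw [norm_mul]
      exact mul_le_mul ((norm_sub_le _ _).trans (add_le_add (hz k) (hz l))) (ih k l)
        (norm_nonneg _) (by positivity)
    rw [newtonCoeff]
    calc _ ≤ _ := (norm_sub_le _ _).trans (add_le_add_left (norm_add_le _ _) _)
      _ ≤ (s + s) * ((s ^ (k + l))⁻¹ * (4 * s) ^ m) + s * ((s ^ (k + l))⁻¹ * (4 * s) ^ m) +
          s * ((s ^ (k + l))⁻¹ * (4 * s) ^ m) := by gcongr
      _ = _ := by ring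

theorem newtonCoeff_zero (m k l : ℕ) :
    newtonCoeff 0 m k l = if k + l = m then (-1) ^ l * ((k + l).choose k : ℂ) else 0 := by
  induction m generalizing k l with
  | zero =>
    rw [newtonCoeff]
    by_cases h : k = 0 ∧ l = 0
    · simp [h.1, h.2]
    · rw [if_neg h, if_neg (by omega)]
  | succ m ih =>
    rw [newtonCoeff]
    rcases k with _ | k <;> rcases l with _ | l
    · simp [shiftSeq]
    · simp only [shiftSeq, ih, Pi.zero_apply]
      by_cases h : l = m
      · subst h
        simp [pow_succ]
      · simp [h]
    · simp only [shiftSeq, ih, Pi.zero_apply]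
      by_cases h : k = m
      · subst h
        simp
      · simp [h]
    · simp only [shiftSeq, ih, Pi.zero_apply]
      by_cases h : k + l + 1 = m
      · subst h
        rw [if_pos (show k + (l + 1) = k + l + 1 by omega),
          if_pos (show k + 1 + l = k + l + 1 by omega),
          if_pos (show k + 1 + (l + 1) = k + l + 1 + 1 by omega),
          show k + 1 + (l + 1) = k + l + 1 + 1 by ring, Nat.choose_succ_succ,
          show k + (l + 1) = k + l + 1 by ring, show k + 1 + l = k + l + 1 by ring]
        push_cast
        ring
      · rw [if_neg (show ¬ k + (l + 1) = m by omega), if_neg (show ¬ k + 1 + l = m by omega),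
          if_neg (show ¬ k + 1 + (l + 1) = m + 1 by omega)]
        ring

end NewtonBasis

section PfaffianLimit

open Filter Topology

theorem prod_range_eq_prod_fin {N : ℕ} (g : ℕ → ℂ) (i : Fin N) :
    ∏ k ∈ Finset.range i, g k = ∏ j : Fin N, if j < i then g j else 1 := by
  have h := Fin.prod_univ_eq_prod_range (fun k => if k < (i : ℕ) then g k else 1) N
  simp only [Fin.lt_def]
  rw [h, ← Finset.prod_filter]
  congr 1
  ext k
  simp only [Finset.mem_range, Finset.mem_filter]
  omega

theorem prod_prod_lt_const (n : ℕ) (a : ℂ) :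
    ∏ i : Fin (2 * n), ∏ j : Fin (2 * n), (if i < j then a else 1) = a ^ (n * (2 * n - 1)) := by
  rw [Finset.prod_comm]
  simp only [← prod_range_eq_prod_fin (fun _ => a), Finset.prod_const, Finset.card_range]
  rw [Fin.prod_univ_eq_prod_range (fun k => a ^ k), Finset.prod_pow_eq_pow_sum,
    Finset.sum_range_id, mul_assoc, Nat.mul_div_cancel_left _ two_pos]

/-- Extension of a finite sequence by zero. -/
def extendSeq {N : ℕ} (z : Fin N → ℂ) (k : ℕ) : ℂ := if h : k < N then z ⟨k, h⟩ else 0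

@[simp] theorem extendSeq_val {N : ℕ} (z : Fin N → ℂ) (i : Fin N) : extendSeq z i = z i := by
  simp [extendSeq]

theorem continuous_extendSeq {N : ℕ} : Continuous (extendSeq (N := N)) := by
  refine continuous_pi fun k => ?_
  by_cases h : k < N
  · simpa [extendSeq, h] using continuous_apply (⟨k, h⟩ : Fin N)
  · simpa [extendSeq, h] using continuous_const

theorem extendSeq_zero {N : ℕ} : extendSeq (0 : Fin N → ℂ) = 0 := by
  ext k
  simp [extendSeq]

theorem norm_extendSeq_le {N : ℕ} {z : Fin N → ℂ} {s : ℝ} (hs : 0 ≤ s) (hz : ‖z‖ ≤ s) (k : ℕ) :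
    ‖extendSeq z k‖ ≤ s := by
  unfold extendSeq
  split_ifs with h
  · exact (norm_le_pi_norm z _).trans hz
  · simpa using hs

/-- The values of the Newton polynomials at their nodes. -/
def newtonMatrix {N : ℕ} (z : Fin N → ℂ) : Matrix (Fin N) (Fin N) ℂ :=
  Matrix.of fun i k => newtonPoly (extendSeq z) k (z i)

theorem newtonPoly_eq_zero {N : ℕ} (z : Fin N → ℂ) {k : ℕ} (i : Fin N) (h : (i : ℕ) < k) :
    newtonPoly (extendSeq z) k (z i) = 0 :=
  Finset.prod_eq_zero (Finset.mem_range.mpr h) (by simp)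

theorem det_newtonMatrix {N : ℕ} (z : Fin N → ℂ) :
    (newtonMatrix z).det = ∏ i, ∏ j, if i < j then z j - z i else 1 := by
  have htri : (newtonMatrix z).IsLowerTriangular := fun i k h => newtonPoly_eq_zero z i h
  rw [Matrix.det_of_isLowerTriangular _ htri, Finset.prod_comm]
  refine Finset.prod_congr rfl fun i _ => ?_
  rw [newtonMatrix, Matrix.of_apply, newtonPoly, prod_range_eq_prod_fin fun k => z i - extendSeq z k]
  simp

theorem prod_sub_eq_det_newtonMatrix {n : ℕ} (z : Fin (2 * n) → ℂ) :
    (∏ i, ∏ j, if i < j then z i - z j else 1) = (-1) ^ n * (newtonMatrix z).det := by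
  have h : ((-1 : ℂ)) ^ n = (-1) ^ (n * (2 * n - 1)) := by
    rcases Nat.eq_zero_or_pos n with rfl | hn
    · simp
    · rw [mul_comm n, pow_mul, Odd.neg_one_pow (n := 2 * n - 1) ⟨n - 1, by omega⟩]
  rw [h, ← prod_prod_lt_const, det_newtonMatrix, ← Finset.prod_mul_distrib]
  refine Finset.prod_congr rfl fun i _ => ?_
  rw [← Finset.prod_mul_distrib]
  refine Finset.prod_congr rfl fun j _ => ?_
  split_ifs <;> ring

/-- The coefficients of `∑ m, c m * (x - y) ^ m` in products of Newton polynomials. -/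
def newtonSeries (c : ℕ → ℂ) {N : ℕ} (z : Fin N → ℂ) : Matrix (Fin N) (Fin N) ℂ :=
  Matrix.of fun k l => ∑' m, c m * newtonCoeff (extendSeq z) m k l

variable {c : ℕ → ℂ} {f : ℂ → ℂ} {ρ : ℝ}

theorem summable_newtonBound (hρ : 0 < ρ)
    (hf : ∀ u, ‖u‖ < ρ → HasSum (fun l => c l * u ^ l) (f u)) (A : ℝ) :
    Summable fun m => ‖c m‖ * (A * (4 * (ρ / 8)) ^ m) := by
  have hρ2 : ‖((ρ / 2 : ℝ) : ℂ)‖ = ρ / 2 := by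
    rw [Complex.norm_real, Real.norm_of_nonneg (by positivity)]
  have h := ((hf ((ρ / 2 : ℝ) : ℂ) (by rw [hρ2]; linarith)).summable.norm).mul_left A
  refine h.congr fun m => ?_
  rw [norm_mul, norm_pow, hρ2, show 4 * (ρ / 8) = ρ / 2 by ring]
  ring

theorem norm_newtonTerm_le (hρ : 0 < ρ) {N : ℕ} {z : Fin N → ℂ} (hz : ‖z‖ ≤ ρ / 8) (m k l : ℕ) :
    ‖c m * newtonCoeff (extendSeq z) m k l‖ ≤
      ‖c m‖ * ((((ρ / 8) ^ (k + l))⁻¹) * (4 * (ρ / 8)) ^ m) := by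
  rw [norm_mul]
  gcongr
  exact norm_newtonCoeff_le (by positivity) (norm_extendSeq_le (by positivity) hz) m k l

theorem eq_newtonMatrix_mul (hρ : 0 < ρ)
    (hf : ∀ u, ‖u‖ < ρ → HasSum (fun l => c l * u ^ l) (f u)) {N : ℕ} {z : Fin N → ℂ}
    (hz : ‖z‖ ≤ ρ / 8) :
    (Matrix.of fun i j => f (z i - z j)) =
      newtonMatrix z * newtonSeries c z * (newtonMatrix z).transpose := by
  ext i j
  have hs : ∀ k l : ℕ, HasSum (fun m => c m * newtonCoeff (extendSeq z) m k l)
      (∑' m, c m * newtonCoeff (extendSeq z) m k l) := fun k l =>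
    (Summable.of_norm_bounded (summable_newtonBound hρ hf _)
      fun m => norm_newtonTerm_le hρ hz m k l).hasSum
  have hnorm : ‖z i - z j‖ < ρ := by
    have h1 := (norm_le_pi_norm z i).trans hz
    have h2 := (norm_le_pi_norm z j).trans hz
    have h3 := norm_sub_le (z i) (z j)
    linarith
  have h1 : HasSum (fun m => ∑ k ∈ Finset.range N, ∑ l ∈ Finset.range N,
      newtonPoly (extendSeq z) k (z i) * (c m * newtonCoeff (extendSeq z) m k l) *
        newtonPoly (extendSeq z) l (z j)) (∑ k ∈ Finset.range N, ∑ l ∈ Finset.range N,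
      newtonPoly (extendSeq z) k (z i) * (∑' m, c m * newtonCoeff (extendSeq z) m k l) *
        newtonPoly (extendSeq z) l (z j)) :=
    hasSum_sum fun k _ => hasSum_sum fun l _ => ((hs k l).mul_left _).mul_right _
  have h2 : ∀ m, ∑ k ∈ Finset.range N, ∑ l ∈ Finset.range N,
      newtonPoly (extendSeq z) k (z i) * (c m * newtonCoeff (extendSeq z) m k l) *
        newtonPoly (extendSeq z) l (z j) = c m * (z i - z j) ^ m := by
    intro m
    rw [← sum_newtonCoeff (i.pos) (newtonPoly_eq_zero z i i.isLt)
      (newtonPoly_eq_zero z j j.isLt) m, Finset.mul_sum]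
    refine Finset.sum_congr rfl fun k _ => ?_
    rw [Finset.mul_sum]
    exact Finset.sum_congr rfl fun l _ => by ring
  simp only [h2] at h1
  rw [Matrix.of_apply, (hf _ hnorm).unique h1]
  simp only [Matrix.mul_apply, Matrix.transpose_apply, newtonMatrix, newtonSeries,
    Matrix.of_apply, Finset.sum_mul]
  rw [Finset.sum_comm, ← Fin.sum_univ_eq_sum_range fun l => ∑ k ∈ Finset.range N,
    newtonPoly (extendSeq z) k (z i) * (∑' m, c m * newtonCoeff (extendSeq z) m k l) *
        newtonPoly (extendSeq z) l (z j)]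
  refine Finset.sum_congr rfl fun l _ => ?_
  rw [← Fin.sum_univ_eq_sum_range fun k =>
    newtonPoly (extendSeq z) k (z i) * (∑' m, c m * newtonCoeff (extendSeq z) m k l) *
        newtonPoly (extendSeq z) l (z j)]

/-- The value of `newtonSeries` when all nodes coalesce at zero. -/
theorem newtonSeries_zero (N : ℕ) : newtonSeries c (0 : Fin N → ℂ) =
    Matrix.of fun k l : Fin N =>
      c (k + l) * ((-1) ^ (l : ℕ) * (((k : ℕ) + (l : ℕ)).choose k : ℂ)) := by
  ext k l
  rw [newtonSeries, Matrix.of_apply, extendSeq_zero, tsum_eq_single ((k : ℕ) + l)]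
  · simp [newtonCoeff_zero]
  · intro m hm
    rw [newtonCoeff_zero, if_neg (Ne.symm hm), mul_zero]

theorem tendsto_newtonSeries (hρ : 0 < ρ)
    (hf : ∀ u, ‖u‖ < ρ → HasSum (fun l => c l * u ^ l) (f u)) {N : ℕ} (k l : Fin N) :
    Tendsto (fun z : Fin N → ℂ => newtonSeries c z k l) (𝓝 0) (𝓝 (newtonSeries c 0 k l)) := by
  simp only [newtonSeries, Matrix.of_apply]
  refine tendsto_tsum_of_dominated_convergence 
    (summable_newtonBound hρ hf (((ρ / 8) ^ ((k : ℕ) + l))⁻¹)) (fun m => ?_) ?_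
  · have h := (continuous_newtonCoeff m k l).comp (continuous_extendSeq (N := N))
    exact (h.tendsto 0).const_mul (c m)
  · have h : ∀ᶠ z : Fin N → ℂ in 𝓝 0, ‖z‖ ≤ ρ / 8 :=
      (continuous_norm.tendsto' 0 0 norm_zero).eventually_le_const (by positivity)
    filter_upwards [h] with z hz m
    exact norm_newtonTerm_le hρ hz m k l

theorem tendsto_pf {ι : Type*} {F : Filter ι} {m : ℕ}
    {A : ι → Matrix (Fin (2 * m)) (Fin (2 * m)) ℂ} {B : Matrix (Fin (2 * m)) (Fin (2 * m)) ℂ}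
    (h : ∀ i j, Tendsto (fun t => A t i j) F (𝓝 (B i j))) :
    Tendsto (fun t => pf (A t)) F (𝓝 (pf B)) := by
  unfold pf
  exact (tendsto_finsetSum _ fun σ _ => (tendsto_finsetProd _ fun j _ => h _ _).const_mul _).const_mul _

theorem pf_newtonSeries_zero {n : ℕ} (heven : ∀ l, Even l → c l = 0) :
    pf (newtonSeries c (0 : Fin (2 * n) → ℂ)) =
      Matrix.det (Matrix.of fun i j : Fin n =>
        -(c (2 * (i + j : ℕ) + 1) * ((2 * (i + j : ℕ) + 1).choose (2 * i) : ℂ))) := by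
  rw [newtonSeries_zero, pf_eq_det_of_bipartite]
  · congr 1
    ext i j
    simp only [Matrix.of_apply, pairEquiv_val]
    rw [show 2 * (i : ℕ) + ((0 : Fin 2) : ℕ) + (2 * (j : ℕ) + ((1 : Fin 2) : ℕ)) =
      2 * (i + j : ℕ) + 1 by simp; ring]
    simp [pow_succ, pow_mul]
  · intro a b
    simp only [Matrix.of_apply]
    rw [add_comm (b : ℕ) a]
    rcases Nat.even_or_odd ((a : ℕ) + b) with h | h
    · simp [heven _ h]
    · rw [Nat.choose_symm_add]
      have : ((-1 : ℂ)) ^ (a : ℕ) = -(-1) ^ (b : ℕ) := by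
        rcases Nat.odd_add.mp h with h'
        rcases Nat.even_or_odd (b : ℕ) with hb | hb
        · rw [hb.neg_one_pow, (h'.mpr hb).neg_one_pow]
        · rw [hb.neg_one_pow, Even.neg_one_pow, neg_neg]
          rw [← Nat.not_odd_iff_even, h', Nat.not_even_iff_odd]
          exact hb
      rw [this]
      ring
  · intro b i j
    simp only [Matrix.of_apply, pairEquiv_val]
    rw [heven _ ⟨(i + j + b : ℕ), by ring⟩, zero_mul]

/-- Confluent limit of the pfaffian of an odd function of differences. -/
theorem tendsto_pf_div (hρ : 0 < ρ)
    (hf : ∀ u, ‖u‖ < ρ → HasSum (fun l => c l * u ^ l) (f u)) (heven : ∀ l, Even l → c l = 0)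
    (n : ℕ) :
    Tendsto (fun z : Fin (2 * n) → ℂ => pf (Matrix.of fun i j => f (z i - z j)) /
        ∏ i, ∏ j, if i < j then z i - z j else 1)
      (𝓝[{z : Fin (2 * n) → ℂ | Function.Injective z}] 0)
      (𝓝 ((-1) ^ n * Matrix.det (Matrix.of fun i j : Fin n =>
        -(c (2 * (i + j : ℕ) + 1) * ((2 * (i + j : ℕ) + 1).choose (2 * i) : ℂ))))) := by
  rw [← pf_newtonSeries_zero heven]
  have hlim := (tendsto_pf (F := 𝓝[{z : Fin (2 * n) → ℂ | Function.Injective z}] 0)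
    fun i j => (tendsto_newtonSeries hρ hf i j).mono_left nhdsWithin_le_nhds).const_mul
      ((-1 : ℂ) ^ n)
  refine hlim.congr' ?_
  have h : ∀ᶠ z : Fin (2 * n) → ℂ in 𝓝 0, ‖z‖ ≤ ρ / 8 :=
    (continuous_norm.tendsto' 0 0 norm_zero).eventually_le_const (by positivity)
  filter_upwards [mem_nhdsWithin_of_mem_nhds h, self_mem_nhdsWithin] with z hz hinj
  have hdet : (newtonMatrix z).det ≠ 0 := by
    rw [det_newtonMatrix]
    refine Finset.prod_ne_zero_iff.mpr fun i _ => Finset.prod_ne_zero_iff.mpr fun j _ => ?_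
    split_ifs with hij
    · exact sub_ne_zero.mpr fun h => hij.ne (hinj h.symm)
    · exact one_ne_zero
  have hsign : ((-1 : ℂ) ^ n) * (-1) ^ n = 1 := by rw [← mul_pow]; simp
  rw [eq_newtonMatrix_mul hρ hf hz, pf_mul_mul_transpose, prod_sub_eq_det_newtonMatrix,
    eq_div_iff (mul_ne_zero (pow_ne_zero _ (by norm_num)) hdet)]
  linear_combination (newtonMatrix z).det * pf (newtonSeries c z) * hsign

end PfaffianLimit

section Confluence

open Filter Topology

theorem thetaDen_one {p : ℂ} (hp : ‖p‖ < 1) : thetaDen p 1 = 2 * qpoch (-p ^ 6) (p ^ 6) ^ 2 := by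
  rw [thetaDen_eq hp, thetaDenReg, one_pow, neg_one_mul, div_neg, div_one]
  ring

theorem prod_range_factorial (n : ℕ) : ∏ k ∈ Finset.range (2 * n), (k.factorial : ℂ) =
    (∏ i : Fin n, ((2 * (i : ℕ)).factorial : ℂ)) *
      ∏ i : Fin n, ((2 * (i : ℕ) + 1).factorial : ℂ) := by
  rw [Fin.prod_univ_eq_prod_range (fun i => ((2 * i).factorial : ℂ)),
    Fin.prod_univ_eq_prod_range (fun i => ((2 * i + 1).factorial : ℂ))]
  induction n with
  | zero => simp
  | succ n ih =>
    rw [show 2 * (n + 1) = 2 * n + 1 + 1 by ring, Finset.prod_range_succ, Finset.prod_range_succ, ih,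
      Finset.prod_range_succ, Finset.prod_range_succ]
    ring

theorem prod_pow_even_mul_prod_pow_odd (n : ℕ) (a : ℂ) :
    (∏ i : Fin n, a ^ (2 * (i : ℕ))) * ∏ i : Fin n, a ^ (2 * (i : ℕ) + 1) =
      a ^ (n * (2 * n - 1)) := by
  rw [Fin.prod_univ_eq_prod_range (fun i => a ^ (2 * i)),
    Fin.prod_univ_eq_prod_range (fun i => a ^ (2 * i + 1))]
  induction n with
  | zero => simp
  | succ n ih =>
    rw [Finset.prod_range_succ, Finset.prod_range_succ, mul_mul_mul_comm, ih, ← pow_add, ← pow_add]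
    congr 1
    zify [show 1 ≤ 2 * (n + 1) by omega]
    rcases n with _ | n
    · simp
    · push_cast [show 1 ≤ 2 * (n + 1) by omega]
      ring

theorem det_quotTaylor (p : ℂ) (n : ℕ) :
    (-1) ^ n * Matrix.det (Matrix.of fun i j : Fin n =>
        -(quotTaylor p (2 * (i + j : ℕ) + 1) * ((2 * (i + j : ℕ) + 1).choose (2 * i) : ℂ))) =
      (2 * I * C1 p) ^ n * Real.pi ^ (n * (2 * n - 1)) /
          (∏ j ∈ Finset.range (2 * n), (j.factorial : ℂ)) *
        Matrix.det (Matrix.of fun i j : Fin n => L1 p ((i : ℕ) + (j : ℕ))) := by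
  have hentry : (Matrix.of fun i j : Fin n =>
      -(quotTaylor p (2 * (i + j : ℕ) + 1) * ((2 * (i + j : ℕ) + 1).choose (2 * i) : ℂ))) =
      Matrix.of fun i j : Fin n =>
        (2 * I * C1 p * ((-1) ^ (i : ℕ) * (Real.pi ^ (2 * (i : ℕ)) * ((2 * (i : ℕ)).factorial : ℂ)⁻¹))) *
        Matrix.of (fun i j : Fin n =>
          (-1 * ((-1) ^ (j : ℕ) * (Real.pi ^ (2 * (j : ℕ) + 1) * ((2 * (j : ℕ) + 1).factorial : ℂ)⁻¹))) *
            Matrix.of (fun i j : Fin n => L1 p ((i : ℕ) + (j : ℕ))) i j) i j := by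
    ext i j
    simp only [Matrix.of_apply]
    have hch := Nat.choose_mul_factorial_mul_factorial
      (show 2 * (i : ℕ) ≤ 2 * (i + j : ℕ) + 1 by omega)
    rw [show 2 * (i + j : ℕ) + 1 - 2 * i = 2 * (j : ℕ) + 1 by omega] at hch
    have hch' : (((2 * (i + j : ℕ) + 1).choose (2 * i) : ℕ) : ℂ) * ((2 * (i : ℕ)).factorial : ℂ) *
        ((2 * (j : ℕ) + 1).factorial : ℂ) = ((2 * (i + j : ℕ) + 1).factorial : ℂ) := by
      exact_mod_cast hch
    have f1 : ((2 * (i : ℕ)).factorial : ℂ) ≠ 0 := by exact_mod_cast Nat.factorial_ne_zero _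
    have f2 : ((2 * (j : ℕ) + 1).factorial : ℂ) ≠ 0 := by exact_mod_cast Nat.factorial_ne_zero _
    have f3 : (((2 * (i + j : ℕ) + 1).choose (2 * i) : ℕ) : ℂ) ≠ 0 := by
      exact_mod_cast (Nat.choose_pos (by omega)).ne'
    rw [quotTaylor_odd, ← hch']
    field_simp
    ring
  have hsign : ((-1 : ℂ) ^ n) * ((∏ i : Fin n, (-1 : ℂ) ^ (i : ℕ)) *
      ((-1) ^ n * ∏ i : Fin n, (-1 : ℂ) ^ (i : ℕ))) = 1 := by
    calc _ = ((-1 : ℂ) * -1) ^ n * ∏ i : Fin n, ((-1 : ℂ) * -1) ^ (i : ℕ) := by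
          simp only [mul_pow, Finset.prod_mul_distrib]
          ring
      _ = 1 := by simp
  rw [hentry, Matrix.det_mul_column, Matrix.det_mul_row]
  simp only [Finset.prod_mul_distrib, Finset.prod_const, Finset.card_univ, Fintype.card_fin,
    Finset.prod_inv_distrib]
  rw [prod_range_factorial, ← prod_pow_even_mul_prod_pow_odd n (Real.pi : ℂ), div_eq_mul_inv,
    mul_inv]
  linear_combination ((2 * I * C1 p) ^ n * ((∏ i : Fin n, (Real.pi : ℂ) ^ (2 * (i : ℕ))) *
    ∏ i : Fin n, (Real.pi : ℂ) ^ (2 * (i : ℕ) + 1)) *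
    ((∏ i : Fin n, ((2 * (i : ℕ)).factorial : ℂ))⁻¹ *
      (∏ i : Fin n, ((2 * (i : ℕ) + 1).factorial : ℂ))⁻¹) *
    Matrix.det (Matrix.of fun i j : Fin n => L1 p ((i : ℕ) + (j : ℕ)))) * hsign

theorem pPow_natCast (τ : ℂ) (k : ℕ) : pPow τ k = pPow τ 1 ^ k := by
  rw [pPow, pPow, ← Complex.exp_nat_mul]
  ring_nf

theorem norm_pPow_one_lt {τ : ℂ} (hτ : 0 < τ.im) : ‖pPow τ 1‖ < 1 := by
  rw [pPow, Complex.norm_exp, Real.exp_lt_one_iff]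
  simpa using mul_pos Real.pi_pos hτ

theorem xOf_div (z w : ℂ) : xOf z / xOf w = Complex.exp (Real.pi * I * (z - w)) := by
  rw [xOf, xOf, ← Complex.exp_sub, mul_sub]

theorem P1_eq (n : ℕ) (τ : ℂ) (z : Fin (2 * n) → ℂ) :
    P1 n τ z = (∏ i, ∏ j, if i < j then
      Complex.exp (Real.pi * I * (z j - z i)) ^ 3 *
        thetaDen (pPow τ 1) (Complex.exp (Real.pi * I * (z i - z j))) else 1) *
      pf (Matrix.of fun i j => thetaQuot (pPow τ 1) (z i - z j)) := by
  have h2 : pPow τ 2 = pPow τ 1 ^ 2 := by exact_mod_cast pPow_natCast τ 2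
  have h6 : pPow τ 6 = pPow τ 1 ^ 6 := by exact_mod_cast pPow_natCast τ 6
  simp only [P1, ← div_pow, xOf_div, h2, h6]
  rfl

theorem tendsto_prefactor {p : ℂ} (hp : ‖p‖ < 1) (n : ℕ) :
    Tendsto (fun z : Fin (2 * n) → ℂ => ∏ i, ∏ j, if i < j then
      Complex.exp (Real.pi * I * (z j - z i)) ^ 3 *
        thetaDen p (Complex.exp (Real.pi * I * (z i - z j))) else 1) (𝓝 0)
      (𝓝 ((2 * qpoch (-p ^ 6) (p ^ 6) ^ 2) ^ (n * (2 * n - 1)))) := by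
  rw [← prod_prod_lt_const, ← thetaDen_one hp]
  refine tendsto_finsetProd _ fun i _ => tendsto_finsetProd _ fun j _ => ?_
  split_ifs with hij
  · have hexp : ∀ i j : Fin (2 * n), Tendsto
        (fun z : Fin (2 * n) → ℂ => Complex.exp (Real.pi * I * (z i - z j))) (𝓝 0) (𝓝 1) := by
      intro i j
      have : Continuous fun z : Fin (2 * n) → ℂ => Complex.exp (Real.pi * I * (z i - z j)) := by
        fun_prop
      simpa using this.tendsto 0
    simpa using ((hexp j i).pow 3).mul
      ((differentiableAt_thetaDen hp one_ne_zero).continuousAt.tendsto.comp (hexp i j))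
  · exact tendsto_const_nhds

end Confluence

theorem stmt15 (n : ℕ) (hn : 1 ≤ n) (τ : ℂ) (hτ : 0 < τ.im) :
    Filter.Tendsto
      (fun z : Fin (2 * n) → ℂ =>
        P1 n τ z / ∏ i, ∏ j, if i < j then z i - z j else 1)
      (nhdsWithin 0 {z : Fin (2 * n) → ℂ | Function.Injective z})
      (nhds ((2 * Complex.I * C1 (pPow τ 1)) ^ n * D1 (pPow τ 1) ^ (n * (2 * n - 1)) /
          (∏ j ∈ Finset.range (2 * n), (Nat.factorial j : ℂ)) *
        Matrix.det (Matrix.of fun i j : Fin n => L1 (pPow τ 1) ((i : ℕ) + (j : ℕ))))) := by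
  have hp := norm_pPow_one_lt hτ
  obtain ⟨ρ, hρ, hf⟩ := exists_hasSum_thetaQuot hp (Complex.exp_ne_zero _)
  have h := ((tendsto_prefactor hp n).mono_left nhdsWithin_le_nhds).mul
    (tendsto_pf_div hρ hf (fun l hl => quotTaylor_even hl) n)
  rw [det_quotTaylor] at h
  convert h using 2
  · rw [P1_eq, mul_div_assoc]
  · rw [D1, mul_right_comm 2 (Real.pi : ℂ), mul_pow _ (Real.pi : ℂ)]
    generalize (2 * qpoch (-pPow τ 1 ^ 6) (pPow τ 1 ^ 6) ^ 2) ^ (n * (2 * n - 1)) = a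
    ring

end
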